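/- arXiv:1812.11796 — 4 statements merged into one kernel-verified Lean document; each statement's English description precedes it below -/
import Mathlib

section
/- ('If' direction of the main theorem on two-variable SDPs with positive duality gaps.) Suppose the two-variable SDP data (A₁, A₂, B, c) is in the standard form (P_ref). Then val(P) = 0 and val(D) > 0; in particular there is a positive duality gap val(P) < val(D). -/
open Matrix

/-- The optimal value of the primal SDP (P):
`sup { c·x : x ∈ ℝ^m, B - ∑ᵢ xᵢ Aᵢ positive semidefinite }`, as an extended real. -/
noncomputable def valP {n m : ℕ} (A : Fin m → Matrix (Fin n) (Fin n) ℝ)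
    (B : Matrix (Fin n) (Fin n) ℝ) (c : Fin m → ℝ) : EReal :=
  sSup ((fun x : Fin m → ℝ => ((∑ i, c i * x i : ℝ) : EReal)) ''
    {x | (B - ∑ i, x i • A i).PosSemidef})

/-- The optimal value of the dual SDP (D):
`inf { trace (B Y) : Y psd, trace (Aᵢ Y) = cᵢ for all i }`, as an extended real. -/
noncomputable def valD {n m : ℕ} (A : Fin m → Matrix (Fin n) (Fin n) ℝ)
    (B : Matrix (Fin n) (Fin n) ℝ) (c : Fin m → ℝ) : EReal :=
  sInf ((fun Y : Matrix (Fin n) (Fin n) ℝ => (((B * Y).trace : ℝ) : EReal)) ''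
    {Y | Y.PosSemidef ∧ ∀ i, ((A i) * Y).trace = c i})

/-- Two-variable SDP data `(A₁, A₂, B, c)` is in the standard form (P_ref):
with respect to the block partition of `{0,…,n-1}` into consecutive blocks of sizes
`p`, `r-p`, `s`, `n-r-s`, we have `B = I_r ⊕ 0`, `A₁ = Λ ⊕ 0` with `Λ` a `p×p`
positive definite diagonal matrix, the `(2,2)` block of `A₂` is a diagonal matrix `Σ`,
its `(3,3)` block is `-I_s`, its `(1,4)` block is a nonzero matrix `M`, its
`(1,1)`, `(1,2)`, `(1,3)` blocks (and symmetric counterparts) are arbitrary, all its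
remaining blocks are zero, and `c = (0, c₂)` with `c₂ > 0`. -/
def StandardForm {n : ℕ} (A1 A2 B : Matrix (Fin n) (Fin n) ℝ) (c : Fin 2 → ℝ) : Prop :=
  A1.IsSymm ∧ A2.IsSymm ∧
  ∃ p r s : ℕ, 1 ≤ p ∧ p ≤ r ∧ r < n ∧ r + s < n ∧
    (∀ a b : Fin n, B a b = if a = b ∧ a.val < r then 1 else 0) ∧
    (∀ a b : Fin n, a ≠ b → A1 a b = 0) ∧
    (∀ a : Fin n, a.val < p → 0 < A1 a a) ∧
    (∀ a : Fin n, p ≤ a.val → A1 a a = 0) ∧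
    (∀ a b : Fin n, p ≤ a.val → a.val < r → p ≤ b.val → b.val < r → a ≠ b → A2 a b = 0) ∧
    (∀ a b : Fin n, r ≤ a.val → a.val < r + s → r ≤ b.val → b.val < r + s →
      A2 a b = if a = b then -1 else 0) ∧
    (∃ a b : Fin n, a.val < p ∧ r + s ≤ b.val ∧ A2 a b ≠ 0) ∧
    (∀ a b : Fin n, p ≤ a.val → a.val < r → r ≤ b.val → A2 a b = 0) ∧
    (∀ a b : Fin n, r ≤ a.val → a.val < r + s → r + s ≤ b.val → A2 a b = 0) ∧
    (∀ a b : Fin n, r + s ≤ a.val → r + s ≤ b.val → A2 a b = 0) ∧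
    c 0 = 0 ∧ 0 < c 1

/-- A real positive semidefinite matrix with a zero diagonal entry vanishes on its row. -/
theorem Matrix.PosSemidef.apply_eq_zero_of_diag_eq_zero {ι : Type*} {M : Matrix ι ι ℝ}
    (hM : M.PosSemidef) {i : ι} (hi : M i i = 0) (j : ι) : M i j = 0 := by
  have hdet := (hM.submatrix ![i, j]).det_nonneg
  have hsymm : M j i = M i j := by simpa using hM.isHermitian.apply i j
  simp only [det_fin_two, submatrix_apply, cons_val_zero, cons_val_one, hi, hsymm] at hdet
  exact mul_self_eq_zero.mp (le_antisymm (by linarith) (mul_self_nonneg _))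

/-- In standard form the objective vanishes on the feasible set of the primal, and the zero
vector is feasible. -/
theorem StandardForm.valP_eq_zero {n : ℕ} {A1 A2 B : Matrix (Fin n) (Fin n) ℝ}
    {c : Fin 2 → ℝ} (h : StandardForm A1 A2 B c) : valP ![A1, A2] B c = 0 := by
  obtain ⟨-, hA2, p, r, s, -, hpr, -, -, hB, hA1off, -, hA1zero, -, -,
    ⟨a, b, ha, hb, hab⟩, -, -, hA2zero, hc0, -⟩ := h
  have hBpsd : B.PosSemidef := by
    have : B = diagonal fun a : Fin n => if a.val < r then (1 : ℝ) else 0 := by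
      ext a b
      rw [hB, diagonal_apply]
      by_cases hab : a = b <;> simp [hab]
    rw [this]
    refine PosSemidef.diagonal fun a => ?_
    dsimp only [Pi.zero_apply]
    split_ifs <;> norm_num
  have hvalue (x : Fin 2 → ℝ) (hx : (B - ∑ i, x i • ![A1, A2] i).PosSemidef) :
      ∑ i, c i * x i = 0 := by
    have hne : b ≠ a := by rintro rfl; omega
    have hdiag : (B - ∑ i, x i • ![A1, A2] i) b b = 0 := by
      simp [Fin.sum_univ_two, hB, hA1zero b (by omega), hA2zero b b hb hb,
        show ¬ b.val < r by omega]
    have hoff := hx.apply_eq_zero_of_diag_eq_zero hdiag a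
    have hx1 : x 1 = 0 := by
      simpa [Fin.sum_univ_two, hB, hA1off b a hne, hne, hA2.apply a b, hab] using hoff
    simp [Fin.sum_univ_two, hc0, hx1]
  refine le_antisymm (sSup_le ?_) (le_sSup ⟨0, by simpa using hBpsd, by simp⟩)
  rintro _ ⟨x, hx, rfl⟩
  simp only [hvalue x hx, EReal.coe_zero, le_refl]

/-- In standard form the value of the dual is bounded away from zero. -/
theorem StandardForm.valD_pos {n : ℕ} {A1 A2 B : Matrix (Fin n) (Fin n) ℝ}
    {c : Fin 2 → ℝ} (h : StandardForm A1 A2 B c) : 0 < valD ![A1, A2] B c := by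
  obtain ⟨-, hA2, p, r, s, -, -, -, -, hB, hA1off, hA1pos, hA1zero, hA22, hA33,
    -, hA2r, hA34, hA2zero, hc0, hc1⟩ := h
  set K : ℝ := 1 + ∑ a, |A2 a a|
  have hK : 0 < K := add_pos_of_pos_of_nonneg one_pos (Finset.sum_nonneg fun _ _ => abs_nonneg _)
  have hbound (Y : Matrix (Fin n) (Fin n) ℝ) (hY : Y.PosSemidef)
      (hY1 : (A1 * Y).trace = 0) : (A2 * Y).trace ≤ K * (B * Y).trace := by
    have hA1Y : ∑ a, A1 a a * Y a a = 0 := by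
      rw [← hY1, trace]
      refine Finset.sum_congr rfl fun a _ => ?_
      rw [diag_apply, mul_apply, Finset.sum_eq_single a]
      · intro b _ hb
        rw [hA1off a b hb.symm, zero_mul]
      · simp
    have hterm (a : Fin n) : 0 ≤ A1 a a * Y a a := by
      rcases lt_or_ge a.val p with ha | ha
      · exact mul_nonneg (hA1pos a ha).le hY.diag_nonneg
      · simp [hA1zero a ha]
    have hYrow (a b : Fin n) (ha : a.val < p) : Y a b = 0 := by
      refine hY.apply_eq_zero_of_diag_eq_zero ?_ b
      have := (Finset.sum_eq_zero_iff_of_nonneg fun a _ => hterm a).mp hA1Y a (Finset.mem_univ a)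
      exact (mul_eq_zero.mp this).resolve_left (hA1pos a ha).ne'
    have hYsymm (a b : Fin n) : Y a b = Y b a := by simpa using hY.isHermitian.apply b a
    have hoff (a b : Fin n) (hab : a ≠ b) : A2 a b * Y b a = 0 := by
      rcases lt_or_ge a.val p with ha | ha
      · rw [hYsymm, hYrow a b ha, mul_zero]
      rcases lt_or_ge b.val p with hb | hb
      · rw [hYrow b a hb, mul_zero]
      suffices A2 a b = 0 by rw [this, zero_mul]
      have hsymm := hA2.apply a b
      rcases lt_or_ge a.val r with ha' | ha' <;> rcases lt_or_ge b.val r with hb' | hb'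
      · exact hA22 a b ha ha' hb hb' hab
      · exact hA2r a b ha ha' hb'
      · exact hsymm ▸ hA2r b a hb hb' ha'
      rcases lt_or_ge a.val (r + s) with ha2 | ha2 <;>
        rcases lt_or_ge b.val (r + s) with hb2 | hb2
      · rw [hA33 a b ha' ha2 hb' hb2, if_neg hab]
      · exact hA34 a b ha' ha2 hb2
      · exact hsymm ▸ hA34 b a hb' hb2 ha2
      · exact hA2zero a b ha2 hb2
    have hdiag (a : Fin n) : A2 a a * Y a a ≤ K * (B a a * Y a a) := by
      have hYa : 0 ≤ Y a a := hY.diag_nonneg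
      rcases lt_or_ge a.val r with ha | ha
      · have hle : A2 a a ≤ K := by
          have := Finset.single_le_sum (f := fun a => |A2 a a|) (fun _ _ => abs_nonneg _)
            (Finset.mem_univ a)
          linarith [le_abs_self (A2 a a)]
        rw [hB, if_pos ⟨rfl, ha⟩, one_mul]
        exact mul_le_mul_of_nonneg_right hle hYa
      · have hle : A2 a a ≤ 0 := by
          rcases lt_or_ge a.val (r + s) with ha2 | ha2
          · simp [hA33 a a ha ha2 ha ha2]
          · exact (hA2zero a a ha2 ha2).le
        rw [hB, if_neg fun h => ha.not_gt h.2, zero_mul, mul_zero]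
        exact mul_nonpos_of_nonpos_of_nonneg hle hYa
    simp only [trace, diag_apply, mul_apply, Finset.mul_sum]
    refine Finset.sum_le_sum fun a _ => ?_
    rw [Finset.sum_eq_single a (fun b _ hb => hoff a b hb.symm) (by simp),
      Finset.sum_eq_single a (fun b _ hb => by simp [hB, hb.symm]) (by simp)]
    exact hdiag a
  have hpos : (0 : EReal) < ((c 1 / K : ℝ) : EReal) := by exact_mod_cast div_pos hc1 hK
  refine hpos.trans_le (le_sInf ?_)
  rintro _ ⟨Y, ⟨hY, hYc⟩, rfl⟩
  have hY1 : (A1 * Y).trace = 0 := by simpa [hc0] using hYc 0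
  have hY2 : (A2 * Y).trace = c 1 := by simpa using hYc 1
  rw [EReal.coe_le_coe_iff, div_le_iff₀ hK, mul_comm, ← hY2]
  exact hbound Y hY hY1

/-- ("If" direction of the main theorem on two variable SDPs with positive gaps.)
If the two-variable SDP data `(A₁, A₂, B, c)` is in the standard form (P_ref), then
`val(P) = 0` and `val(D) > 0`; in particular there is a positive duality gap. -/
theorem standardForm_implies_gap {n : ℕ} (A1 A2 B : Matrix (Fin n) (Fin n) ℝ)
    (c : Fin 2 → ℝ) (h : StandardForm A1 A2 B c) :
    valP ![A1, A2] B c = 0 ∧ 0 < valD ![A1, A2] B c ∧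
      valP ![A1, A2] B c < valD ![A1, A2] B c := by
  have hP := h.valP_eq_zero
  have hD := h.valD_pos
  exact ⟨hP, hD, hP ▸ hD⟩
end

section
/- ('Only if' direction of the main theorem on two-variable SDPs with positive duality gaps.) Let m = 2 and let A₁, A₂, B be linearly independent real symmetric n×n matrices with B = I_r ⊕ 0_{n−r} for some 0 ≤ r < n. Suppose (P) is feasible, every positive semidefinite slack matrix B − x₁A₁ − x₂A₂ has rank at most r, and val(P) < val(D). Then the data (A₁, A₂, B, c) has a reformulation (A₁', A₂', B', c') that is in the standard form (P_ref); in particular B' = I_r ⊕ 0_{n−r}. -/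
open Matrix

/-- `(A', B', c')` is a reformulation of the SDP data `(A, B, c)`:
`A'ᵢ = Tᵀ(∑ⱼ Vᵢⱼ Aⱼ)T`, `c' = V c`, `B' = Tᵀ(B + ∑ⱼ μⱼ Aⱼ)T` with `T`, `V` invertible. -/
def IsReformulation {n m : ℕ} (A : Fin m → Matrix (Fin n) (Fin n) ℝ)
    (B : Matrix (Fin n) (Fin n) ℝ) (c : Fin m → ℝ)
    (A' : Fin m → Matrix (Fin n) (Fin n) ℝ)
    (B' : Matrix (Fin n) (Fin n) ℝ) (c' : Fin m → ℝ) : Prop :=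
  ∃ (T : Matrix (Fin n) (Fin n) ℝ) (V : Matrix (Fin m) (Fin m) ℝ) (μ : Fin m → ℝ),
    IsUnit T ∧ IsUnit V ∧
    (∀ i, A' i = Tᵀ * (∑ j, V i j • A j) * T) ∧
    c' = V.mulVec c ∧
    B' = Tᵀ * (B + ∑ j, μ j • A j) * T

theorem Convex.exists_strongDual_nonneg {E : Type*} [NormedAddCommGroup E] [NormedSpace ℝ E]
    [FiniteDimensional ℝ E] [Nontrivial E] {C : Set E} (hC : Convex ℝ C) (h0 : (0 : E) ∉ C) :
    ∃ f : StrongDual ℝ E, f ≠ 0 ∧ ∀ z ∈ C, 0 ≤ f z := by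
  have : ProperSpace (StrongDual ℝ E) := FiniteDimensional.proper ℝ _
  have key : (Metric.sphere (0 : StrongDual ℝ E) 1 ∩
      ⋂ z : C, {f : StrongDual ℝ E | 0 ≤ f z}).Nonempty := by
    refine (isCompact_sphere _ _).inter_iInter_nonempty _ (fun z => ?_) (fun F => ?_)
    · exact isClosed_le continuous_const (by fun_prop)
    · obtain ⟨f, hf0, hf⟩ : ∃ f : StrongDual ℝ E, f ≠ 0 ∧ ∀ z ∈ F, 0 ≤ f (z : E) := by
        rcases F.eq_empty_or_nonempty with rfl | ⟨z₀, hz₀⟩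
        · obtain ⟨f, hf⟩ := exists_ne (0 : StrongDual ℝ E)
          exact ⟨f, hf, by simp⟩
        · let s : Set E := (fun z : C => (z : E)) '' (F : Set C)
          have hs : s.Finite := F.finite_toSet.image _
          have hsC : convexHull ℝ s ⊆ C := convexHull_min (by rintro _ ⟨z, -, rfl⟩; exact z.2) hC
          obtain ⟨f, u, hu, hf⟩ := geometric_hahn_banach_point_closed (convex_convexHull ℝ s)
            (hs.isClosed_convexHull ℝ) (fun h => h0 (hsC h))
          have hpos : ∀ z ∈ F, 0 < f (z : E) := fun z hz => by
            have := hf z (subset_convexHull ℝ s ⟨z, hz, rfl⟩)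
            rw [map_zero] at hu
            linarith
          refine ⟨f, ?_, fun z hz => (hpos z hz).le⟩
          rintro rfl
          simpa using hpos z₀ hz₀
      refine ⟨‖f‖⁻¹ • f, ?_, ?_⟩
      · simp [norm_smul, hf0]
      · simp only [Set.mem_iInter]
        intro z hz
        have := hf z hz
        simp only [Set.mem_ofPred_eq, _root_.smul_apply, smul_eq_mul]
        positivity
  obtain ⟨f, hf1, hf2⟩ := key
  refine ⟨f, ?_, fun z hz => by simpa using Set.mem_iInter.1 hf2 ⟨z, hz⟩⟩
  rintro rfl
  simp at hf1

theorem Matrix.exists_posSemidef_add_smul {n : ℕ} {Q L : Matrix (Fin n) (Fin n) ℝ}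
    (hQ : Q.IsSymm) (hL : L.PosSemidef)
    (h : ∀ v, L *ᵥ v = 0 → 0 ≤ v ⬝ᵥ Q *ᵥ v ∧ (v ⬝ᵥ Q *ᵥ v = 0 → Q *ᵥ v = 0)) :
    ∃ K : ℝ, 0 ≤ K ∧ (Q + K • L).PosSemidef := by
  let Z : Submodule ℝ (Fin n → ℝ) := Q.mulVecLin.ker ⊓ L.mulVecLin.ker
  obtain ⟨W, hW⟩ := Z.exists_isCompl
  have hL0 : ∀ v, 0 ≤ v ⬝ᵥ L *ᵥ v := fun v => by simpa using hL.dotProduct_mulVec_nonneg v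
  have key : ∃ K : ℕ, ∀ v ∈ W, ‖v‖ = 1 → 0 < v ⬝ᵥ Q *ᵥ v + K * (v ⬝ᵥ L *ᵥ v) := by
    by_contra! hK
    let F : ℕ → Set (Fin n → ℝ) := fun K =>
      (Metric.sphere 0 1 ∩ W) ∩ {v | v ⬝ᵥ Q *ᵥ v + K * (v ⬝ᵥ L *ᵥ v) ≤ 0}
    have hcl : ∀ K, IsClosed {v : Fin n → ℝ | v ⬝ᵥ Q *ᵥ v + K * (v ⬝ᵥ L *ᵥ v) ≤ 0} := fun K =>
      isClosed_le (by fun_prop) continuous_const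
    have hcp : IsCompact (Metric.sphere (0 : Fin n → ℝ) 1 ∩ W) :=
      (isCompact_sphere _ _).inter_right W.closed_of_finiteDimensional
    obtain ⟨v, hv⟩ := IsCompact.nonempty_iInter_of_sequence_nonempty_isCompact_isClosed F
      (fun K v hv => ⟨hv.1, by
        have h1 := hv.2
        have h2 := hL0 v
        simp only [Set.mem_ofPred_eq, Nat.cast_add, Nat.cast_one] at h1 ⊢
        linarith⟩)
      (fun K => by
        obtain ⟨v, h1, h2, h3⟩ := hK K
        exact ⟨v, ⟨by simpa using h2, h1⟩, h3⟩)
      (hcp.inter_right (by simpa using hcl 0))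
      (fun K => hcp.isClosed.inter (hcl K))
    simp only [F, Set.mem_iInter] at hv
    have hLv : v ⬝ᵥ L *ᵥ v = 0 := by
      by_contra hne
      have hpos := lt_of_le_of_ne (hL0 v) (Ne.symm hne)
      obtain ⟨K, hK'⟩ := exists_nat_gt (-(v ⬝ᵥ Q *ᵥ v) / (v ⬝ᵥ L *ᵥ v))
      rw [div_lt_iff₀ hpos] at hK'
      have := (hv K).2
      simp only [Set.mem_ofPred_eq] at this
      linarith
    have hLv' : L *ᵥ v = 0 := (hL.dotProduct_mulVec_zero_iff v).1 (by simpa using hLv)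
    have hQv : v ⬝ᵥ Q *ᵥ v = 0 := by
      have := (hv 0).2
      simp only [Set.mem_ofPred_eq, hLv] at this
      linarith [(h v hLv').1]
    have hZ : v ∈ Z := ⟨(h v hLv').2 hQv, hLv'⟩
    have h0 : v = 0 := by
      have : v ∈ Z ⊓ W := ⟨hZ, (hv 0).1.2⟩
      rwa [hW.inf_eq_bot, Submodule.mem_bot] at this
    have := (hv 0).1.1
    simp [h0] at this
  obtain ⟨K, hK⟩ := key
  have hQL : (Q + (K : ℝ) • L).IsSymm := hQ.add (IsSymm.smul (by simpa using hL.isHermitian) _)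
  refine ⟨K, by positivity,
    posSemidef_iff_dotProduct_mulVec.2 ⟨by simpa [IsHermitian, IsSymm] using hQL,
    fun x => ?_⟩⟩
  obtain ⟨z, hz, w, hw, rfl⟩ : ∃ z ∈ Z, ∃ w ∈ W, z + w = x := by
    have : x ∈ Z ⊔ W := by rw [hW.sup_eq_top]; trivial
    exact Submodule.mem_sup.1 this
  have hz0 : (Q + (K : ℝ) • L) *ᵥ z = 0 := by
    have h1 : Q *ᵥ z = 0 := hz.1
    have h2 : L *ᵥ z = 0 := hz.2
    simp [add_mulVec, smul_mulVec, h1, h2]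
  have hz1 : z ⬝ᵥ (Q + (K : ℝ) • L) *ᵥ w = 0 := by
    rw [dotProduct_mulVec, ← mulVec_transpose, hQL.eq, hz0, zero_dotProduct]
  have e : ∀ v, v ⬝ᵥ (Q + (K : ℝ) • L) *ᵥ v = v ⬝ᵥ Q *ᵥ v + K * (v ⬝ᵥ L *ᵥ v) := fun v => by
    simp [add_mulVec, smul_mulVec, dotProduct_add]
  simp only [star_trivial, mulVec_add, hz0, zero_add, add_dotProduct, hz1]
  rcases eq_or_ne w 0 with rfl | hw0
  · simp
  · have := hK (‖w‖⁻¹ • w) (W.smul_mem _ hw) (by simp [norm_smul, hw0])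
    rw [e]
    simp only [mulVec_smul, dotProduct_smul, smul_dotProduct, smul_eq_mul] at this
    have hn : 0 < ‖w‖ := norm_pos_iff.2 hw0
    have h2 : 0 < ‖w‖⁻¹ * ‖w‖⁻¹ * (w ⬝ᵥ Q *ᵥ w + K * (w ⬝ᵥ L *ᵥ w)) := by linarith
    exact (pos_of_mul_pos_right h2 (by positivity)).le

theorem Matrix.IsSymm.exists_orthonormal_diagonalizing {n : ℕ}
    (S : Submodule ℝ (EuclideanSpace ℝ (Fin n))) {A : Matrix (Fin n) (Fin n) ℝ} (hA : A.IsSymm) :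
    ∃ b : ℕ → Fin n → ℝ, (∀ i < Module.finrank ℝ S, WithLp.toLp 2 (b i) ∈ S) ∧
      (∀ i < Module.finrank ℝ S, ∀ j < Module.finrank ℝ S, b i ⬝ᵥ b j = if i = j then 1 else 0) ∧
      (∀ i < Module.finrank ℝ S, ∀ j < Module.finrank ℝ S, i ≠ j → b i ⬝ᵥ A *ᵥ b j = 0) := by
  let f := A.toEuclideanLin
  have hf : f.IsSymmetric := isSymmetric_toEuclideanLin_iff.2
    (by simpa [IsHermitian, IsSymm] using hA)
  let T : S →ₗ[ℝ] S := S.orthogonalProjectionOnto.toLinearMap ∘ₗ f ∘ₗ S.subtype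
  have hT' : ∀ x y : S,
      inner ℝ x (T y) = inner ℝ (x : EuclideanSpace ℝ (Fin n)) (f y) := fun x y => by
    simp [T]
  have hT : T.IsSymmetric := fun x y => by
    rw [hT', real_inner_comm, hT', real_inner_comm]
    exact hf _ _
  let e := hT.eigenvectorBasis rfl
  have hinner : ∀ x y : Fin n → ℝ,
      x ⬝ᵥ y = inner ℝ (WithLp.toLp 2 x) (WithLp.toLp 2 y) := fun x y => by
    simp [EuclideanSpace.inner_eq_star_dotProduct, dotProduct_comm]
  refine ⟨fun i => if h : i < Module.finrank ℝ S then
    WithLp.ofLp (e ⟨i, h⟩ : EuclideanSpace ℝ (Fin n))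
    else 0, fun i hi => by simp [hi], fun i hi j hj => ?_, fun i hi j hj hij => ?_⟩
  · have := orthonormal_iff_ite.1 e.orthonormal ⟨i, hi⟩ ⟨j, hj⟩
    simpa [hi, hj, hinner] using this
  · have h1 := hT' (e ⟨i, hi⟩) (e ⟨j, hj⟩)
    have h2 := orthonormal_iff_ite.1 e.orthonormal ⟨i, hi⟩ ⟨j, hj⟩
    rw [hT.apply_eigenvectorBasis, inner_smul_right, h2] at h1
    simp [hij, f] at h1
    simp [hi, hj, hinner]
    exact h1.symm

theorem Matrix.trace_mul_smul_vecMulVec_self {n : ℕ} (A : Matrix (Fin n) (Fin n) ℝ)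
    (k : ℝ) (v : Fin n → ℝ) : (A * (k • vecMulVec v v)).trace = k * (v ⬝ᵥ A *ᵥ v) := by
  rw [mul_smul_comm, trace_smul, mul_vecMulVec, trace_vecMulVec, dotProduct_comm, smul_eq_mul]

theorem Matrix.posSemidef_smul_vecMulVec_self {n : ℕ} {k : ℝ} (hk : 0 ≤ k) (v : Fin n → ℝ) :
    (k • vecMulVec v v).PosSemidef := by
  simpa using (posSemidef_vecMulVec_self_star v).smul hk

theorem exists_posSemidef_pencil_of_gap {n : ℕ} {A1 A2 B : Matrix (Fin n) (Fin n) ℝ}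
    {c0 c1 w : ℝ} (hA1 : A1.IsSymm) (hA2 : A2.IsSymm) (hB : B.PosSemidef)
    (hP : ∀ x0 x1 : ℝ, (B - (x0 • A1 + x1 • A2)).PosSemidef → c0 * x0 + c1 * x1 < w)
    (hD : ∀ Y : Matrix (Fin n) (Fin n) ℝ, Y.PosSemidef → (A1 * Y).trace = c0 →
      (A2 * Y).trace = c1 → w < (B * Y).trace) :
    ∃ x0 x1 : ℝ, (x0 ≠ 0 ∨ x1 ≠ 0) ∧ (x0 • A1 + x1 • A2).PosSemidef ∧ c0 * x0 + c1 * x1 = 0 := by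
  have hBs : B.IsSymm := by simpa [IsHermitian, IsSymm] using hB.isHermitian
  let C : Set (Fin 3 → ℝ) := {z | ∃ Y : Matrix (Fin n) (Fin n) ℝ, Y.PosSemidef ∧ ∃ s : ℝ, 0 ≤ s ∧
    z = ![(A1 * Y).trace - c0, (A2 * Y).trace - c1, (B * Y).trace + s - w]}
  have hC : Convex ℝ C := by
    rintro _ ⟨Y, hY, s, hs, rfl⟩ _ ⟨Y', hY', s', hs', rfl⟩ a b ha hb hab
    refine ⟨a • Y + b • Y', (hY.smul ha).add (hY'.smul hb), a * s + b * s', by positivity, ?_⟩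
    obtain rfl : b = 1 - a := by linarith
    ext i
    fin_cases i <;> simp [mul_add] <;> ring
  have h0 : (0 : Fin 3 → ℝ) ∉ C := by
    rintro ⟨Y, hY, s, hs, h⟩
    have e0 := congrFun h 0
    have e1 := congrFun h 1
    have e2 := congrFun h 2
    simp at e0 e1 e2
    have := hD Y hY (by linarith) (by linarith)
    linarith
  obtain ⟨f, hf0, hf⟩ := hC.exists_strongDual_nonneg h0
  obtain ⟨y, hy⟩ : ∃ y : Fin 3 → ℝ, ∀ z, f z = ∑ i, z i * y i :=
    ⟨_, fun z => by simpa using f.toLinearMap.pi_apply_eq_sum_univ z⟩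
  have key : ∀ (v : Fin n → ℝ) (k s : ℝ), 0 ≤ k → 0 ≤ s →
      0 ≤ k * (v ⬝ᵥ (y 2 • B + (y 0 • A1 + y 1 • A2)) *ᵥ v) + s * y 2 - w * y 2
        - (c0 * y 0 + c1 * y 1) := fun v k s hk hs => by
    have := hf _ ⟨_, posSemidef_smul_vecMulVec_self hk v, s, hs, rfl⟩
    rw [hy] at this
    simp only [trace_mul_smul_vecMulVec_self, Fin.sum_univ_three] at this
    simp [add_mulVec, smul_mulVec] at this ⊢
    linarith
  have lin : ∀ a b : ℝ, (∀ k, 0 ≤ k → 0 ≤ k * a + b) → 0 ≤ a := fun a b h => by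
    by_contra! ha
    have h1 := h ((|b| + 1) / -a) (by have : 0 < -a := by linarith
                                      positivity)
    have h2 : (|b| + 1) / -a * a = -(|b| + 1) := by
      rw [div_neg, neg_mul, div_mul_cancel₀ _ ha.ne]
    rw [h2] at h1
    linarith [le_abs_self b]
  have hy2 : 0 ≤ y 2 := lin _ (- w * y 2 - (c0 * y 0 + c1 * y 1)) fun k hk => by
    have := key 0 0 k le_rfl hk
    linarith
  have hpsd : (y 2 • B + (y 0 • A1 + y 1 • A2)).PosSemidef := by
    refine posSemidef_iff_dotProduct_mulVec.2 ⟨?_, fun v => ?_⟩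
    · have : (y 2 • B + (y 0 • A1 + y 1 • A2)).IsSymm :=
        (hBs.smul _).add ((hA1.smul _).add (hA2.smul _))
      rwa [IsHermitian, conjTranspose_eq_transpose_of_trivial]
    · refine lin _ (- w * y 2 - (c0 * y 0 + c1 * y 1)) fun k hk => ?_
      have := key v k 0 hk le_rfl
      simp only [star_trivial]
      linarith
  have hval : c0 * y 0 + c1 * y 1 + w * y 2 ≤ 0 := by
    have := key 0 0 0 le_rfl le_rfl
    linarith
  have hy20 : y 2 = 0 := by
    by_contra hne
    have hpos : 0 < y 2 := lt_of_le_of_ne hy2 (Ne.symm hne)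
    have := hP (-(y 0 / y 2)) (-(y 1 / y 2)) (by
      convert hpsd.smul (inv_nonneg.2 hy2) using 1
      simp only [smul_add, smul_smul, inv_mul_cancel₀ hne, one_smul, neg_smul]
      rw [← neg_add, sub_neg_eq_add, div_eq_inv_mul, div_eq_inv_mul])
    have h2 : c0 * -(y 0 / y 2) + c1 * -(y 1 / y 2) = -(c0 * y 0 + c1 * y 1) / y 2 := by
      field_simp
      ring
    rw [h2, div_lt_iff₀ hpos] at this
    linarith
  rw [hy20, zero_smul, zero_add] at hpsd
  rw [hy20, mul_zero, add_zero] at hval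
  refine ⟨y 0, y 1, ?_, hpsd, le_antisymm hval ?_⟩
  · by_contra! h
    apply hf0
    ext z
    simp [hy, Fin.sum_univ_three, h.1, h.2, hy20]
  · refine lin _ w fun t ht => ?_
    have := hP (-(t * y 0)) (-(t * y 1)) (by
      convert hB.add (hpsd.smul ht) using 1
      simp only [smul_add, smul_smul, neg_smul]
      rw [← neg_add, sub_neg_eq_add])
    linarith

theorem Matrix.transpose_mul_mul_apply_eq_dotProduct {n : ℕ} (M T : Matrix (Fin n) (Fin n) ℝ)
    (a b : Fin n) : (Tᵀ * M * T) a b = T.col a ⬝ᵥ M *ᵥ T.col b := by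
  rw [mul_assoc, mul_apply_eq_vecMul]
  simp [vecMul, dotProduct, mul_apply, mulVec, col]

theorem Matrix.IsSymm.dotProduct_mulVec_comm {n : ℕ} {M : Matrix (Fin n) (Fin n) ℝ}
    (hM : M.IsSymm) (v w : Fin n → ℝ) : v ⬝ᵥ M *ᵥ w = w ⬝ᵥ M *ᵥ v := by
  rw [dotProduct_mulVec, ← mulVec_transpose, hM.eq, dotProduct_comm]

theorem exists_isUnit_standardForm_of_vectors {n p q s t : ℕ} (hn : p + q + s + t = n)
    {A1 A2 B : Matrix (Fin n) (Fin n) ℝ} (hA1 : A1.IsSymm) (hA2 : A2.IsSymm) (hA1ne : A1 ≠ 0)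
    (hB : ∀ a b : Fin n, B a b = if a = b ∧ a.val < p + q then 1 else 0)
    (x1 x2 x3 x4 : ℕ → Fin n → ℝ)
    (b11 : ∀ i < p, ∀ j < p, x1 i ⬝ᵥ B *ᵥ x1 j = if i = j then 1 else 0)
    (b12 : ∀ i < p, ∀ j < q, x1 i ⬝ᵥ B *ᵥ x2 j = 0)
    (b22 : ∀ i < q, ∀ j < q, x2 i ⬝ᵥ B *ᵥ x2 j = if i = j then 1 else 0)
    (b3 : ∀ i < s, B *ᵥ x3 i = 0) (b4 : ∀ i < t, B *ᵥ x4 i = 0)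
    (a11 : ∀ i < p, ∀ j < p, i ≠ j → x1 i ⬝ᵥ A1 *ᵥ x1 j = 0)
    (a11pos : ∀ i < p, 0 < x1 i ⬝ᵥ A1 *ᵥ x1 i)
    (a2 : ∀ i < q, A1 *ᵥ x2 i = 0) (a3 : ∀ i < s, A1 *ᵥ x3 i = 0)
    (a4 : ∀ i < t, A1 *ᵥ x4 i = 0)
    (c22 : ∀ i < q, ∀ j < q, i ≠ j → x2 i ⬝ᵥ A2 *ᵥ x2 j = 0)
    (c23 : ∀ i < q, ∀ j < s, x2 i ⬝ᵥ A2 *ᵥ x3 j = 0)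
    (c24 : ∀ i < q, ∀ j < t, x2 i ⬝ᵥ A2 *ᵥ x4 j = 0)
    (c33 : ∀ i < s, ∀ j < s, x3 i ⬝ᵥ A2 *ᵥ x3 j = if i = j then -1 else 0)
    (c34 : ∀ i < s, ∀ j < t, x3 i ⬝ᵥ A2 *ᵥ x4 j = 0)
    (c44 : ∀ i < t, ∀ j < t, x4 i ⬝ᵥ A2 *ᵥ x4 j = 0)
    (o44 : ∀ i < t, ∀ j < t, x4 i ⬝ᵥ x4 j = if i = j then 1 else 0)
    (hM : ∃ v, B *ᵥ v = 0 ∧ (∀ w, B *ᵥ w = 0 → w ⬝ᵥ A2 *ᵥ v = 0) ∧ A2 *ᵥ v ≠ 0)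
    {c2 : ℝ} (hc2 : 0 < c2) :
    ∃ T : Matrix (Fin n) (Fin n) ℝ, IsUnit T ∧ Tᵀ * B * T = B ∧
      StandardForm (Tᵀ * A1 * T) (Tᵀ * A2 * T) B ![0, c2] := by
  let col : Fin n → Fin n → ℝ := fun i =>
    if i.val < p then x1 i else if i.val < p + q then x2 (i - p)
    else if i.val < p + q + s then x3 (i - (p + q)) else x4 (i - (p + q + s))
  let T : Matrix (Fin n) (Fin n) ℝ := (of col)ᵀ
  have hTcol : ∀ a, T.col a = col a := fun a => rfl
  have hcol : ∀ a : Fin n, (a.val < p ∧ col a = x1 a) ∨ (∃ i < q, a.val = p + i ∧ col a = x2 i) ∨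
      (∃ i < s, a.val = p + q + i ∧ col a = x3 i) ∨
      (∃ i < t, a.val = p + q + s + i ∧ col a = x4 i) := fun a => by
    by_cases h1 : a.val < p
    · exact Or.inl ⟨h1, by simp [col, h1]⟩
    by_cases h2 : a.val < p + q
    · exact Or.inr (Or.inl ⟨a - p, by omega, by omega, by simp [col, h1, h2]⟩)
    by_cases h3 : a.val < p + q + s
    · exact Or.inr (Or.inr (Or.inl ⟨a - (p + q), by omega, by omega, by simp [col, h1, h2, h3]⟩))
    · exact Or.inr (Or.inr (Or.inr ⟨a - (p + q + s), by omega, by omega,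
        by simp [col, h1, h2, h3]⟩))
  have hBs : B.IsSymm := by
    ext a b
    simp only [transpose_apply, hB]
    grind
  have entry : ∀ M : Matrix (Fin n) (Fin n) ℝ, ∀ a b, (Tᵀ * M * T) a b = col a ⬝ᵥ M *ᵥ col b :=
    fun M a b => by rw [transpose_mul_mul_apply_eq_dotProduct, hTcol, hTcol]
  have hlow : ∀ a : Fin n, p + q ≤ a.val → B *ᵥ col a = 0 := fun a ha => by
    rcases hcol a with ⟨h, -⟩ | ⟨i, hi, h, -⟩ | ⟨i, hi, h, e⟩ | ⟨i, hi, h, e⟩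
    · omega
    · omega
    · rw [e, b3 i hi]
    · rw [e, b4 i hi]
  have hA1z : ∀ a : Fin n, p ≤ a.val → A1 *ᵥ col a = 0 := fun a ha => by
    rcases hcol a with ⟨h, -⟩ | ⟨i, hi, h, e⟩ | ⟨i, hi, h, e⟩ | ⟨i, hi, h, e⟩
    · omega
    · rw [e, a2 i hi]
    · rw [e, a3 i hi]
    · rw [e, a4 i hi]
  have hTB : Tᵀ * B * T = B := by
    ext a b
    rw [entry, hB]
    by_cases hb : p + q ≤ b.val
    · rw [hlow b hb, dotProduct_zero, if_neg]
      rintro ⟨rfl, h⟩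
      omega
    by_cases ha : p + q ≤ a.val
    · rw [hBs.dotProduct_mulVec_comm, hlow a ha, dotProduct_zero, if_neg]
      omega
    rcases hcol a with ⟨h, e⟩ | ⟨i, hi, h, e⟩ | ⟨i, hi, h, e⟩ | ⟨i, hi, h, e⟩ <;>
    rcases hcol b with ⟨h', e'⟩ | ⟨j, hj, h', e'⟩ | ⟨j, hj, h', e'⟩ | ⟨j, hj, h', e'⟩ <;>
    try omega
    · rw [e, e', b11 _ h _ h']
      simp only [Fin.ext_iff]
      grind
    · rw [e, e', b12 _ h _ hj, if_neg]
      rw [Fin.ext_iff]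
      omega
    · rw [e, e', hBs.dotProduct_mulVec_comm, b12 _ h' _ hi, if_neg]
      rw [Fin.ext_iff]
      omega
    · rw [e, e', b22 _ hi _ hj]
      simp only [Fin.ext_iff]
      grind
  have h33 : ∀ a b : Fin n, p + q ≤ a.val → a.val < p + q + s → p + q ≤ b.val →
      col a ⬝ᵥ A2 *ᵥ col b = if a = b then -1 else 0 := fun a b ha ha' hb => by
    rcases hcol a with ⟨h, e⟩ | ⟨i, hi, h, e⟩ | ⟨i, hi, h, e⟩ | ⟨i, hi, h, e⟩ <;>
    rcases hcol b with ⟨h', e'⟩ | ⟨j, hj, h', e'⟩ | ⟨j, hj, h', e'⟩ | ⟨j, hj, h', e'⟩ <;>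
    try omega
    · rw [e, e', c33 _ hi _ hj]
      simp only [Fin.ext_iff]
      grind
    · rw [e, e', c34 _ hi _ hj, if_neg]
      rw [Fin.ext_iff]
      omega
  have h44 : ∀ a b : Fin n, p ≤ a.val → p + q + s ≤ b.val → col a ⬝ᵥ A2 *ᵥ col b = 0 :=
      fun a b ha hb => by
    rcases hcol a with ⟨h, e⟩ | ⟨i, hi, h, e⟩ | ⟨i, hi, h, e⟩ | ⟨i, hi, h, e⟩ <;>
    rcases hcol b with ⟨h', e'⟩ | ⟨j, hj, h', e'⟩ | ⟨j, hj, h', e'⟩ | ⟨j, hj, h', e'⟩ <;>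
    try omega
    · rw [e, e', c24 _ hi _ hj]
    · rw [e, e', c34 _ hi _ hj]
    · rw [e, e', c44 _ hi _ hj]
  have hTx : ∀ M : Matrix (Fin n) (Fin n) ℝ, ∀ x a,
      ((Tᵀ * M * T) *ᵥ x) a = col a ⬝ᵥ M *ᵥ (T *ᵥ x) := fun M x a => by
    rw [← mulVec_mulVec, ← mulVec_mulVec]
    rfl
  have hx12 : ∀ x, B *ᵥ (T *ᵥ x) = 0 → ∀ a : Fin n, a.val < p + q → x a = 0 := fun x hx a ha => by
    have h := hTx B x a
    rw [hx, dotProduct_zero, hTB] at h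
    simpa [mulVec, dotProduct, hB, ha] using h
  have hx3 : ∀ x, B *ᵥ (T *ᵥ x) = 0 →
      (∀ w, B *ᵥ w = 0 → w ⬝ᵥ A2 *ᵥ (T *ᵥ x) = 0) →
      ∀ a : Fin n, a.val < p + q + s → x a = 0 := fun x hx hx' a ha => by
    by_cases ha' : a.val < p + q
    · exact hx12 x hx a ha'
    push Not at ha'
    have h := hTx A2 x a
    rw [hx' _ (hlow a ha'), mulVec, dotProduct, Finset.sum_eq_single a] at h
    · rw [entry, h33 a a ha' ha ha'] at h
      simpa using h
    · intro b _ hba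
      by_cases hb : b.val < p + q
      · rw [hx12 x hx b hb, mul_zero]
      · rw [entry, h33 a b ha' ha (by omega), if_neg hba.symm, zero_mul]
    · simp
  have hT : IsUnit T := by
    rw [← mulVec_injective_iff_isUnit]
    refine (injective_iff_map_eq_zero T.mulVecLin).2 fun x hx => ?_
    replace hx : T *ᵥ x = 0 := hx
    have h3 := hx3 x (by rw [hx, mulVec_zero]) (by simp [hx])
    funext a
    by_cases ha : a.val < p + q + s
    · exact h3 a ha
    have h : col a ⬝ᵥ (T *ᵥ x) = 0 := by rw [hx, dotProduct_zero]
    rw [dotProduct_mulVec, dotProduct, Finset.sum_eq_single a] at h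
    · rcases hcol a with ⟨h', e⟩ | ⟨i, hi, h', e⟩ | ⟨i, hi, h', e⟩ | ⟨i, hi, h', e⟩ <;> try omega
      have : (col a ᵥ* T) a = 1 := by
        change col a ⬝ᵥ col a = 1
        rw [e, o44 i hi i hi, if_pos rfl]
      simpa [this] using h
    · intro b _ hba
      by_cases hb : b.val < p + q + s
      · rw [h3 b hb, mul_zero]
      · have : (col a ᵥ* T) b = 0 := by
          change col a ⬝ᵥ col b = 0
          rcases hcol a with ⟨h', e⟩ | ⟨i, hi, h', e⟩ | ⟨i, hi, h', e⟩ | ⟨i, hi, h', e⟩ <;>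
          rcases hcol b with ⟨k', e'⟩ | ⟨j, hj, k', e'⟩ | ⟨j, hj, k', e'⟩ | ⟨j, hj, k', e'⟩ <;>
          try omega
          rw [e, e', o44 i hi j hj, if_neg]
          rintro rfl
          exact hba (Fin.ext (by omega))
        rw [this, zero_mul]
    · simp
  have hTt : ∀ y, Tᵀ *ᵥ y = 0 → y = 0 := fun y hy =>
    mulVec_injective_iff_isUnit.2 ((isUnit_transpose T).2 hT) (hy.trans (mulVec_zero _).symm)
  have hM' : ∃ a b : Fin n, a.val < p ∧ p + q + s ≤ b.val ∧ (Tᵀ * A2 * T) a b ≠ 0 := by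
    by_contra! h
    obtain ⟨v, hv1, hv2, hv3⟩ := hM
    obtain ⟨x, rfl⟩ := (mulVec_surjective_iff_isUnit.2 hT) v
    have h3 := hx3 x hv1 hv2
    apply hv3
    apply hTt
    rw [mulVec_mulVec, mulVec_mulVec]
    funext a
    change ∑ b, (Tᵀ * A2 * T) a b * x b = 0
    refine Finset.sum_eq_zero fun b _ => ?_
    by_cases hb : b.val < p + q + s
    · rw [h3 b hb, mul_zero]
    · by_cases ha : a.val < p
      · rw [h a b ha (by omega), zero_mul]
      · rw [entry, h44 a b (by omega) (by omega), zero_mul]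
  have hp : 1 ≤ p := by
    by_contra! hp
    apply hA1ne
    have h0 : A1 * T = 0 := by
      ext a b
      exact congrFun (hA1z b (by omega)) a
    simpa using (hT.mul_left_eq_zero).1 h0
  have hsymm : ∀ M : Matrix (Fin n) (Fin n) ℝ, M.IsSymm → (Tᵀ * M * T).IsSymm := fun M hM => by
    rw [IsSymm, transpose_mul, transpose_mul, transpose_transpose, hM.eq, mul_assoc]
  refine ⟨T, hT, hTB, hsymm _ hA1, hsymm _ hA2, p, p + q, s, hp, by omega, ?_, ?_, hB, ?_, ?_, ?_,
    ?_, ?_, hM', ?_, ?_, ?_, by simp, by simpa using hc2⟩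
  · obtain ⟨a, b, -, hb, -⟩ := hM'
    omega
  · obtain ⟨a, b, -, hb, -⟩ := hM'
    omega
  · intro a b hab
    rw [entry]
    by_cases hb : p ≤ b.val
    · rw [hA1z b hb, dotProduct_zero]
    by_cases ha : p ≤ a.val
    · rw [hA1.dotProduct_mulVec_comm, hA1z a ha, dotProduct_zero]
    rcases hcol a with ⟨h, e⟩ | ⟨i, hi, h, e⟩ | ⟨i, hi, h, e⟩ | ⟨i, hi, h, e⟩ <;>
    rcases hcol b with ⟨h', e'⟩ | ⟨j, hj, h', e'⟩ | ⟨j, hj, h', e'⟩ | ⟨j, hj, h', e'⟩ <;>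
    try omega
    rw [e, e', a11 _ h _ h' (fun h => hab (Fin.ext h))]
  · intro a ha
    rw [entry]
    rcases hcol a with ⟨h, e⟩ | ⟨i, hi, h, e⟩ | ⟨i, hi, h, e⟩ | ⟨i, hi, h, e⟩ <;> try omega
    rw [e]
    exact a11pos _ h
  · intro a ha
    rw [entry, hA1z a ha, dotProduct_zero]
  · intro a b ha ha' hb hb' hab
    rw [entry]
    rcases hcol a with ⟨h, e⟩ | ⟨i, hi, h, e⟩ | ⟨i, hi, h, e⟩ | ⟨i, hi, h, e⟩ <;>
    rcases hcol b with ⟨h', e'⟩ | ⟨j, hj, h', e'⟩ | ⟨j, hj, h', e'⟩ | ⟨j, hj, h', e'⟩ <;>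
    try omega
    rw [e, e', c22 _ hi _ hj]
    rintro rfl
    exact hab (Fin.ext (by omega))
  · intro a b ha ha' hb hb'
    rw [entry, h33 a b ha ha' hb]
  · intro a b ha ha' hb
    rw [entry]
    rcases hcol a with ⟨h, e⟩ | ⟨i, hi, h, e⟩ | ⟨i, hi, h, e⟩ | ⟨i, hi, h, e⟩ <;>
    rcases hcol b with ⟨h', e'⟩ | ⟨j, hj, h', e'⟩ | ⟨j, hj, h', e'⟩ | ⟨j, hj, h', e'⟩ <;>
    try omega
    · rw [e, e', c23 _ hi _ hj]
    · rw [e, e', c24 _ hi _ hj]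
  · intro a b ha ha' hb
    rw [entry, h44 a b (by omega) hb]
  · intro a b ha hb
    rw [entry, h44 a b (by omega) hb]

theorem Matrix.rank_add_finrank_ker_toEuclideanLin {n : ℕ} (M : Matrix (Fin n) (Fin n) ℝ) :
    M.rank + Module.finrank ℝ M.toEuclideanLin.ker = n := by
  have h := M.toEuclideanLin.finrank_range_add_finrank_ker
  rw [finrank_euclideanSpace_fin] at h
  rw [rank_eq_finrank_range_toLin M (PiLp.basisFun 2 ℝ (Fin n)) (PiLp.basisFun 2 ℝ (Fin n)),
    ← toLpLin_eq_toLin 2 2]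
  exact h

theorem Matrix.eq_diagonal_of_apply_eq_ite {n r : ℕ} {B : Matrix (Fin n) (Fin n) ℝ}
    (hB : ∀ a b : Fin n, B a b = if a = b ∧ a.val < r then 1 else 0) :
    B = diagonal fun a => if a.val < r then 1 else 0 := by
  ext a b
  rw [hB, diagonal_apply]
  grind

theorem Matrix.rank_of_apply_eq_ite {n r : ℕ} {B : Matrix (Fin n) (Fin n) ℝ} (hrn : r ≤ n)
    (hB : ∀ a b : Fin n, B a b = if a = b ∧ a.val < r then 1 else 0) : B.rank = r := by
  rw [eq_diagonal_of_apply_eq_ite hB, rank_diagonal]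
  simp [Fintype.card_subtype, Fin.card_filter_val_lt, hrn]

theorem exists_isUnit_standardForm {n r : ℕ} {A1 A2 B : Matrix (Fin n) (Fin n) ℝ}
    (hA1 : A1.PosSemidef) (hA2 : A2.IsSymm) (hA1ne : A1 ≠ 0) (hrn : r < n)
    (hB : ∀ a b : Fin n, B a b = if a = b ∧ a.val < r then 1 else 0)
    (hker : ∀ v, B *ᵥ v = 0 → A1 *ᵥ v = 0)
    (hneg : ∀ v, B *ᵥ v = 0 → v ⬝ᵥ A2 *ᵥ v ≤ 0)
    (hcross : ∀ u v, A1 *ᵥ u = 0 → B *ᵥ v = 0 → v ⬝ᵥ A2 *ᵥ v = 0 → u ⬝ᵥ A2 *ᵥ v = 0)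
    (hM : ∃ v, B *ᵥ v = 0 ∧ v ⬝ᵥ A2 *ᵥ v = 0 ∧ A2 *ᵥ v ≠ 0)
    {c2 : ℝ} (hc2 : 0 < c2) :
    ∃ T : Matrix (Fin n) (Fin n) ℝ, IsUnit T ∧ Tᵀ * B * T = B ∧
      StandardForm (Tᵀ * A1 * T) (Tᵀ * A2 * T) B ![0, c2] := by
  have hA1s : A1.IsSymm := by simpa [IsHermitian, IsSymm] using hA1.isHermitian
  have hBs : B.IsSymm := by
    rw [eq_diagonal_of_apply_eq_ite hB]
    exact isSymm_diagonal _
  have hBv : ∀ v a, (B *ᵥ v) a = if a.val < r then v a else 0 := fun v a => by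
    rw [eq_diagonal_of_apply_eq_ite hB, mulVec_diagonal]
    simp
  have hinner : ∀ x y : EuclideanSpace ℝ (Fin n), inner ℝ x y = WithLp.ofLp x ⬝ᵥ WithLp.ofLp y :=
    fun x y => by
      simp [EuclideanSpace.inner_eq_star_dotProduct, dotProduct_comm]
  let L := B.toEuclideanLin.ker
  have hL : ∀ v : Fin n → ℝ, WithLp.toLp 2 v ∈ L ↔ B *ᵥ v = 0 := fun v => by
    simp [L, LinearMap.mem_ker]
  have hLo : ∀ v : Fin n → ℝ, WithLp.toLp 2 v ∈ Lᗮ → B *ᵥ v = v := fun v hv => by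
    funext a
    rw [hBv]
    split_ifs with ha
    · rfl
    · have he : WithLp.toLp 2 (Pi.single a 1 : Fin n → ℝ) ∈ L := by
        rw [hL]
        funext b
        rw [hBv]
        split_ifs with hb
        · rw [Pi.single_eq_of_ne]
          · rfl
          · rintro rfl
            exact ha hb
        · rfl
      have := (Submodule.mem_orthogonal _ _).1 hv _ he
      rw [hinner] at this
      simpa using this.symm
  have hLfin : Module.finrank ℝ L = n - r := by
    have := B.rank_add_finrank_ker_toEuclideanLin
    rw [rank_of_apply_eq_ite hrn.le hB] at this
    change r + Module.finrank ℝ L = n at this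
    omega
  have hLofin : Module.finrank ℝ Lᗮ = r := by
    have := L.finrank_add_finrank_orthogonal
    rw [finrank_euclideanSpace_fin] at this
    omega
  let S2 := Lᗮ ⊓ A1.toEuclideanLin.ker
  let S1 := S2ᗮ ⊓ Lᗮ
  let S4 := L ⊓ Lᗮ.comap A2.toEuclideanLin
  let S3 := S4ᗮ ⊓ L
  have hpq : Module.finrank ℝ S1 + Module.finrank ℝ S2 = r := by
    rw [add_comm, ← hLofin]
    exact Submodule.finrank_add_inf_finrank_orthogonal inf_le_left
  have hst : Module.finrank ℝ S3 + Module.finrank ℝ S4 = n - r := by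
    rw [add_comm, ← hLfin]
    exact Submodule.finrank_add_inf_finrank_orthogonal inf_le_left
  have hS2 : ∀ v : Fin n → ℝ, WithLp.toLp 2 v ∈ S2 → A1 *ᵥ v = 0 := fun v hv => by
    simpa [LinearMap.mem_ker] using hv.2
  -- a vector of `ker B` isotropic for `A2` is in the radical of `A2` on `ker B`
  have hiso : ∀ v, B *ᵥ v = 0 → v ⬝ᵥ A2 *ᵥ v = 0 → ∀ w, B *ᵥ w = 0 → w ⬝ᵥ A2 *ᵥ v = 0 :=
    fun v hv hv0 w hw => hcross w v (hker w hw) hv hv0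
  have hS4 : ∀ v : Fin n → ℝ, WithLp.toLp 2 v ∈ S4 ↔ B *ᵥ v = 0 ∧ v ⬝ᵥ A2 *ᵥ v = 0 := fun v => by
    have h4 : WithLp.toLp 2 v ∈ S4 ↔ B *ᵥ v = 0 ∧ ∀ w, B *ᵥ w = 0 → w ⬝ᵥ A2 *ᵥ v = 0 := by
      rw [Submodule.mem_inf, hL, Submodule.mem_comap, Submodule.mem_orthogonal]
      refine and_congr_right fun _ => ⟨fun h w hw => ?_, fun h w hw => ?_⟩
      · simpa [hinner] using h _ ((hL w).2 hw)
      · simpa [hinner] using h (WithLp.ofLp w) ((hL _).1 hw)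
    rw [h4]
    exact ⟨fun h => ⟨h.1, h.2 v h.1⟩, fun h => ⟨h.1, hiso v h.1 h.2⟩⟩
  have hself : ∀ (S : Submodule ℝ (EuclideanSpace ℝ (Fin n))) (v : Fin n → ℝ),
      WithLp.toLp 2 v ∈ S → WithLp.toLp 2 v ∈ Sᗮ → v ⬝ᵥ v = 0 := fun S v h h' => by
    simpa [hinner] using (Submodule.mem_orthogonal _ _).1 h' _ h
  have hpos1 : ∀ v : Fin n → ℝ, WithLp.toLp 2 v ∈ S1 → v ⬝ᵥ v = 1 → 0 < v ⬝ᵥ A1 *ᵥ v :=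
      fun v hv hv1 => by
    refine lt_of_le_of_ne (by simpa using hA1.dotProduct_mulVec_nonneg v) fun h => ?_
    have h0 : A1 *ᵥ v = 0 := (hA1.dotProduct_mulVec_zero_iff v).1 (by simpa using h.symm)
    have := hself S2 v ⟨hv.2, by simpa [LinearMap.mem_ker] using h0⟩ hv.1
    linarith
  have hneg3 : ∀ v : Fin n → ℝ, WithLp.toLp 2 v ∈ S3 → v ⬝ᵥ v = 1 → v ⬝ᵥ A2 *ᵥ v < 0 :=
      fun v hv hv1 => by
    have hvL := (hL v).1 hv.2
    refine lt_of_le_of_ne (hneg v hvL) fun h => ?_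
    have := hself S4 v ((hS4 v).2 ⟨hvL, h⟩) hv.1
    linarith
  obtain ⟨x1, x1S, x1o, x1d⟩ := hA1s.exists_orthonormal_diagonalizing S1
  obtain ⟨y3, y3S, y3o, y3d⟩ := hA2.exists_orthonormal_diagonalizing S3
  obtain ⟨x4, x4S, x4o, -⟩ := hA2.exists_orthonormal_diagonalizing S4
  set p := Module.finrank ℝ S1
  set q := Module.finrank ℝ S2
  set s := Module.finrank ℝ S3
  set t := Module.finrank ℝ S4
  obtain ⟨x3, x3L, x3d⟩ : ∃ x3 : ℕ → Fin n → ℝ, (∀ i < s, B *ᵥ x3 i = 0) ∧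
      ∀ i < s, ∀ j < s, x3 i ⬝ᵥ A2 *ᵥ x3 j = if i = j then -1 else 0 := by
    refine ⟨fun i => (√(-(y3 i ⬝ᵥ A2 *ᵥ y3 i)))⁻¹ • y3 i, fun i hi => ?_, fun i hi j hj => ?_⟩
    · rw [mulVec_smul, (hL _).1 (y3S i hi).2, smul_zero]
    · simp only [mulVec_smul, dotProduct_smul, smul_dotProduct, smul_eq_mul]
      split_ifs with hij
      · subst hij
        have h := hneg3 _ (y3S i hi) (by rw [y3o i hi i hi, if_pos rfl])
        have h1 : √(-(y3 i ⬝ᵥ A2 *ᵥ y3 i)) * √(-(y3 i ⬝ᵥ A2 *ᵥ y3 i)) = -(y3 i ⬝ᵥ A2 *ᵥ y3 i) :=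
          Real.mul_self_sqrt (by linarith)
        rw [← mul_assoc, ← mul_inv, h1, inv_neg, neg_mul, inv_mul_cancel₀ h.ne]
      · rw [y3d i hi j hj hij, mul_zero, mul_zero]
  have a3 : ∀ i < s, A1 *ᵥ x3 i = 0 := fun i hi => hker _ (x3L i hi)
  -- the shear along the `x3 j` making the zero block of `A1` orthogonal to them
  let R : (Fin n → ℝ) → Fin n → ℝ := fun u =>
    u + ∑ j ∈ Finset.range s, (u ⬝ᵥ A2 *ᵥ x3 j) • x3 j
  let P : Matrix (Fin n) (Fin n) ℝ :=
    1 + ∑ j ∈ Finset.range s, vecMulVec (x3 j) (A2 *ᵥ x3 j)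
  have hP : ∀ u, P *ᵥ u = R u := fun u => by
    simp only [P, R, add_mulVec, one_mulVec, sum_mulVec, vecMulVec_mulVec]
    congr 1
    refine Finset.sum_congr rfl fun j _ => ?_
    rw [dotProduct_comm]
    simp
  have hRA : ∀ u, A1 *ᵥ R u = A1 *ᵥ u := fun u => by
    simp only [R, mulVec_add, mulVec_sum, mulVec_smul]
    rw [Finset.sum_eq_zero, add_zero]
    intro j hj
    rw [a3 j (Finset.mem_range.1 hj), smul_zero]
  have hRB : ∀ u, B *ᵥ R u = B *ᵥ u := fun u => by
    simp only [R, mulVec_add, mulVec_sum, mulVec_smul]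
    rw [Finset.sum_eq_zero, add_zero]
    intro j hj
    rw [x3L j (Finset.mem_range.1 hj), smul_zero]
  have hR3 : ∀ u, ∀ k < s, R u ⬝ᵥ A2 *ᵥ x3 k = 0 := fun u k hk => by
    simp only [R, add_dotProduct, sum_dotProduct, smul_dotProduct, smul_eq_mul]
    rw [Finset.sum_eq_single k]
    · rw [x3d k hk k hk, if_pos rfl]
      ring
    · intro j hj hjk
      rw [x3d j (Finset.mem_range.1 hj) k hk, if_neg hjk, mul_zero]
    · intro h
      exact absurd (Finset.mem_range.2 hk) h
  have hPs : (Pᵀ * A2 * P).IsSymm := by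
    rw [IsSymm, transpose_mul, transpose_mul, transpose_transpose, hA2.eq, mul_assoc]
  obtain ⟨y2, y2S, y2o, y2d⟩ := hPs.exists_orthonormal_diagonalizing S2
  have hRR : ∀ u v, u ⬝ᵥ (Pᵀ * A2 * P) *ᵥ v = R u ⬝ᵥ A2 *ᵥ R v := fun u v => by
    rw [← hP, ← hP, ← mulVec_mulVec, ← mulVec_mulVec, dotProduct_mulVec, vecMul_transpose]
  have hBRR : ∀ u v, R u ⬝ᵥ B *ᵥ R v = u ⬝ᵥ B *ᵥ v := fun u v => by
    rw [hRB, hBs.dotProduct_mulVec_comm, hRB, hBs.dotProduct_mulVec_comm]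
  have ha2 : ∀ i < q, A1 *ᵥ R (y2 i) = 0 := fun i hi => by rw [hRA, hS2 _ (y2S i hi)]
  refine exists_isUnit_standardForm_of_vectors (p := p) (q := q) (s := s) (t := t) (by omega)
    hA1s hA2 hA1ne (by rwa [hpq]) x1 (fun i => R (y2 i)) x3 x4 ?_ ?_ ?_ x3L ?_ x1d ?_ ha2 a3 ?_
    ?_ ?_ ?_ x3d ?_ ?_ x4o ?_ hc2
  · intro i hi j hj
    rw [hLo _ (x1S j hj).2, x1o i hi j hj]
  · intro i hi j hj
    rw [hRB, hLo _ (y2S j hj).1, dotProduct_comm]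
    simpa [hinner] using (Submodule.mem_orthogonal _ _).1 (x1S i hi).1 _ (y2S j hj)
  · intro i hi j hj
    rw [hBRR, hLo _ (y2S j hj).1, y2o i hi j hj]
  · exact fun i hi => ((hS4 _).1 (x4S i hi)).1
  · exact fun i hi => hpos1 _ (x1S i hi) (by rw [x1o i hi i hi, if_pos rfl])
  · exact fun i hi => hker _ ((hS4 _).1 (x4S i hi)).1
  · exact fun i hi j hj hij => by rw [← hRR, y2d i hi j hj hij]
  · exact fun i hi j hj => hR3 _ j hj
  · exact fun i hi j hj => hcross _ _ (ha2 i hi) ((hS4 _).1 (x4S j hj)).1 ((hS4 _).1 (x4S j hj)).2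
  · exact fun i hi j hj => hcross _ _ (a3 i hi) ((hS4 _).1 (x4S j hj)).1 ((hS4 _).1 (x4S j hj)).2
  · exact fun i hi j hj => hcross _ _ (hker _ ((hS4 _).1 (x4S i hi)).1)
      ((hS4 _).1 (x4S j hj)).1 ((hS4 _).1 (x4S j hj)).2
  · obtain ⟨v, hv, hv0, hv1⟩ := hM
    exact ⟨v, hv, hiso v hv hv0, hv1⟩

theorem exists_isUnit_standardForm_of_gap {n r : ℕ} {A1 A2 B : Matrix (Fin n) (Fin n) ℝ}
    {w c2 : ℝ} (hA1 : A1.PosSemidef) (hA2 : A2.IsSymm) (hA1ne : A1 ≠ 0) (hrn : r < n)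
    (hB : ∀ a b : Fin n, B a b = if a = b ∧ a.val < r then 1 else 0) (hBpsd : B.PosSemidef)
    (hrank : (B + A1).rank ≤ r) (hw : 0 < w) (hc2 : 0 < c2)
    (hP : ∀ x1 x2 : ℝ, (B - (x1 • A1 + x2 • A2)).PosSemidef → c2 * x2 < w)
    (hD : ∀ Y : Matrix (Fin n) (Fin n) ℝ, Y.PosSemidef → (A1 * Y).trace = 0 →
      (A2 * Y).trace = c2 → w < (B * Y).trace) :
    ∃ T : Matrix (Fin n) (Fin n) ℝ, IsUnit T ∧ Tᵀ * B * T = B ∧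
      StandardForm (Tᵀ * A1 * T) (Tᵀ * A2 * T) B ![0, c2] := by
  have hBs : B.IsSymm := by simpa [IsHermitian, IsSymm] using hBpsd.isHermitian
  have hA1nn : ∀ v, 0 ≤ v ⬝ᵥ A1 *ᵥ v := fun v => by simpa using hA1.dotProduct_mulVec_nonneg v
  have hBnn : ∀ v, 0 ≤ v ⬝ᵥ B *ᵥ v := fun v => by simpa using hBpsd.dotProduct_mulVec_nonneg v
  have hB0 : ∀ v, v ⬝ᵥ B *ᵥ v = 0 → B *ᵥ v = 0 := fun v h =>
    (hBpsd.dotProduct_mulVec_zero_iff v).1 (by simpa using h)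
  have hker : ∀ v, B *ᵥ v = 0 → A1 *ᵥ v = 0 := by
    have hle : (B + A1).toEuclideanLin.ker ≤ B.toEuclideanLin.ker := fun v hv => by
      have hv' : (B + A1) *ᵥ WithLp.ofLp v = 0 := by
        simpa [LinearMap.mem_ker, toLpLin_apply, -map_add] using hv
      have h : WithLp.ofLp v ⬝ᵥ (B + A1) *ᵥ WithLp.ofLp v = 0 := by rw [hv', dotProduct_zero]
      rw [add_mulVec, dotProduct_add] at h
      have := hB0 (WithLp.ofLp v) (by linarith [hBnn (WithLp.ofLp v), hA1nn (WithLp.ofLp v)])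
      simpa [LinearMap.mem_ker, toLpLin_apply, -map_add] using this
    have heq := Submodule.eq_of_le_of_finrank_le hle (by
      have h1 := (B + A1).rank_add_finrank_ker_toEuclideanLin
      have h2 := B.rank_add_finrank_ker_toEuclideanLin
      rw [rank_of_apply_eq_ite hrn.le hB] at h2
      omega)
    intro v hv
    have hv' : WithLp.toLp 2 v ∈ B.toEuclideanLin.ker := by
      simpa [LinearMap.mem_ker] using hv
    rw [← heq] at hv'
    have : (B + A1) *ᵥ v = 0 := by simpa [LinearMap.mem_ker, -map_add] using hv'
    rwa [add_mulVec, hv, zero_add] at this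
  have hrankOne : ∀ v, A1 *ᵥ v = 0 → 0 < v ⬝ᵥ A2 *ᵥ v →
      w < c2 / (v ⬝ᵥ A2 *ᵥ v) * (v ⬝ᵥ B *ᵥ v) := fun v hv hpos => by
    have := hD _ (posSemidef_smul_vecMulVec_self (by positivity : 0 ≤ c2 / (v ⬝ᵥ A2 *ᵥ v)) v)
      (by rw [trace_mul_smul_vecMulVec_self, hv, dotProduct_zero, mul_zero])
      (by rw [trace_mul_smul_vecMulVec_self, div_mul_cancel₀ _ hpos.ne'])
    rwa [trace_mul_smul_vecMulVec_self] at this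
  have hneg : ∀ v, B *ᵥ v = 0 → v ⬝ᵥ A2 *ᵥ v ≤ 0 := fun v hv => by
    by_contra! hpos
    have := hrankOne v (hker v hv) hpos
    rw [hv, dotProduct_zero, mul_zero] at this
    linarith
  refine exists_isUnit_standardForm hA1 hA2 hA1ne hrn hB hker hneg (fun u v hu hv hv0 => ?_) ?_ hc2
  · by_contra hg
    have huB := hBnn u
    set g := u ⬝ᵥ A2 *ᵥ v
    set d := √(w / (u ⬝ᵥ B *ᵥ u + 1))
    have hd : 0 < d := Real.sqrt_pos.2 (by positivity)
    have hdd : d * d * (u ⬝ᵥ B *ᵥ u + 1) = w := by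
      rw [Real.mul_self_sqrt (by positivity)]
      exact div_mul_cancel₀ _ (by positivity)
    obtain ⟨K, hK⟩ : ∃ K, d * d * (u ⬝ᵥ A2 *ᵥ u) + 2 * d * K * g = c2 :=
      ⟨(c2 - d * d * (u ⬝ᵥ A2 *ᵥ u)) / (2 * d * g), by field_simp; ring⟩
    have hz : (d • u + K • v) ⬝ᵥ A2 *ᵥ (d • u + K • v) = c2 := by
      rw [← hK]
      simp only [mulVec_add, mulVec_smul, dotProduct_add, add_dotProduct, dotProduct_smul,
        smul_dotProduct, smul_eq_mul, hv0, hA2.dotProduct_mulVec_comm v u]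
      ring
    have hzB : (d • u + K • v) ⬝ᵥ B *ᵥ (d • u + K • v) = d * d * (u ⬝ᵥ B *ᵥ u) := by
      simp only [mulVec_add, mulVec_smul, dotProduct_add, add_dotProduct, dotProduct_smul,
        smul_dotProduct, smul_eq_mul, hv, hBs.dotProduct_mulVec_comm v u, dotProduct_zero]
      ring
    have := hrankOne (d • u + K • v) (by
      rw [mulVec_add, mulVec_smul, mulVec_smul, hu, hker v hv, smul_zero, smul_zero, add_zero])
      (by rw [hz]; exact hc2)
    rw [hz, hzB, div_self hc2.ne', one_mul] at this
    nlinarith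
  · by_contra! hM
    obtain ⟨K, -, hK⟩ := exists_posSemidef_add_smul (Q := B - (w / c2) • A2)
      (hBs.sub (hA2.smul _)) hA1 (fun v hv => by
        rw [sub_mulVec, smul_mulVec, dotProduct_sub, dotProduct_smul, smul_eq_mul]
        by_cases hpos : 0 < v ⬝ᵥ A2 *ᵥ v
        · have h := hrankOne v hv hpos
          rw [div_mul_eq_mul_div, lt_div_iff₀ hpos] at h
          have : w / c2 * (v ⬝ᵥ A2 *ᵥ v) < v ⬝ᵥ B *ᵥ v := by
            rw [div_mul_eq_mul_div, div_lt_iff₀ hc2]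
            linarith
          exact ⟨by linarith, fun h => by linarith⟩
        · push Not at hpos
          have h1 : 0 ≤ w / c2 * -(v ⬝ᵥ A2 *ᵥ v) :=
            mul_nonneg (by positivity) (by linarith)
          have h2 := hBnn v
          refine ⟨by linarith, fun h => ?_⟩
          have hBv := hB0 v (by linarith)
          have hA2v : v ⬝ᵥ A2 *ᵥ v = 0 := by
            have : w / c2 * (v ⬝ᵥ A2 *ᵥ v) = 0 := by linarith
            exact (mul_eq_zero.1 this).resolve_left (by positivity)
          rw [hBv, hM v hBv hA2v, smul_zero, sub_zero])
    have := hP (-K) (w / c2) (by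
      convert hK using 1
      rw [neg_smul]
      abel)
    rw [mul_div_cancel₀ _ hc2.ne'] at this
    exact lt_irrefl _ this

/-- ("Only if" direction of the main theorem on two variable SDPs with positive gaps.)
If `m = 2`, `A₁, A₂, B` are linearly independent symmetric matrices,
`B = I_r ⊕ 0` is a maximum rank slack, (P) is feasible, and `val(P) < val(D)`,
then the SDP data has a reformulation in the standard form (P_ref), with the
right hand side `B` unchanged. -/
theorem gap_implies_standardForm {n r : ℕ}
    (A1 A2 B : Matrix (Fin n) (Fin n) ℝ) (c : Fin 2 → ℝ)
    (hA1 : A1.IsSymm) (hA2 : A2.IsSymm)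
    (hind : LinearIndependent ℝ ![A1, A2, B])
    (hrn : r < n)
    (hB : ∀ a b : Fin n, B a b = if a = b ∧ a.val < r then 1 else 0)
    (hfeas : ∃ x : Fin 2 → ℝ, (B - ∑ i, x i • ![A1, A2] i).PosSemidef)
    (hmaxrank : ∀ x : Fin 2 → ℝ, (B - ∑ i, x i • ![A1, A2] i).PosSemidef →
      (B - ∑ i, x i • ![A1, A2] i).rank ≤ r)
    (hgap : valP ![A1, A2] B c < valD ![A1, A2] B c) :
    ∃ (A1' A2' B' : Matrix (Fin n) (Fin n) ℝ) (c' : Fin 2 → ℝ),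
      IsReformulation ![A1, A2] B c ![A1', A2'] B' c' ∧
      StandardForm A1' A2' B' c' ∧ B' = B := by
  have hBpsd : B.PosSemidef := by
    rw [eq_diagonal_of_apply_eq_ite hB, posSemidef_diagonal_iff]
    intro a
    split_ifs <;> norm_num
  obtain ⟨w, hPw, hwD⟩ := EReal.lt_iff_exists_real_btwn.1 hgap
  have hP : ∀ x : Fin 2 → ℝ, (B - ∑ i, x i • ![A1, A2] i).PosSemidef → ∑ i, c i * x i < w :=
    fun x hx => by
      have h : ((∑ i, c i * x i : ℝ) : EReal) ≤ valP ![A1, A2] B c := le_sSup ⟨x, hx, rfl⟩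
      exact_mod_cast h.trans_lt hPw
  have hD : ∀ Y : Matrix (Fin n) (Fin n) ℝ, Y.PosSemidef → (A1 * Y).trace = c 0 →
      (A2 * Y).trace = c 1 → w < (B * Y).trace := fun Y hY h0 h1 => by
    exact_mod_cast hwD.trans_le (sInf_le (Set.mem_image_of_mem _
      ⟨hY, fun i => by fin_cases i; exacts [h0, h1]⟩))
  have hP' : ∀ x0 x1 : ℝ, (B - (x0 • A1 + x1 • A2)).PosSemidef → c 0 * x0 + c 1 * x1 < w :=
    fun x0 x1 hx => by simpa using hP ![x0, x1] (by simpa using hx)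
  have hw : 0 < w := by simpa using hP' 0 0 (by simpa using hBpsd)
  obtain ⟨x0, x1, hx, hpsd, hcx⟩ := exists_posSemidef_pencil_of_gap hA1 hA2 hBpsd hP' hD
  have hc : c 0 ≠ 0 ∨ c 1 ≠ 0 := by
    by_contra! h
    have := hD 0 PosSemidef.zero (by simp [h.1]) (by simp [h.2])
    simp at this
    linarith
  have hxpos : 0 < x0 * x0 + x1 * x1 := by
    rcases hx with h | h <;> have := mul_self_pos.2 h <;>
      nlinarith [mul_self_nonneg (x0), mul_self_nonneg (x1)]
  have hcpos : 0 < c 0 * c 0 + c 1 * c 1 := by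
    rcases hc with h | h <;> have := mul_self_pos.2 h <;>
      nlinarith [mul_self_nonneg (c 0), mul_self_nonneg (c 1)]
  have hdet : x0 * c 1 - x1 * c 0 ≠ 0 := fun h => by
    have : (x0 * x0 + x1 * x1) * (c 0 * c 0 + c 1 * c 1) = 0 := by
      linear_combination (x0 * c 1 - x1 * c 0) * h + (c 0 * x0 + c 1 * x1) * hcx
    exact (mul_pos hxpos hcpos).ne' this
  have hne : x0 • A1 + x1 • A2 ≠ 0 := fun h => by
    have := Fintype.linearIndependent_iff.1 hind ![x0, x1, 0] (by simp [Fin.sum_univ_three, h])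
    rcases hx with h | h
    · exact h (this 0)
    · exact h (this 1)
  have hrank : (B + (x0 • A1 + x1 • A2)).rank ≤ r := by
    have e : B - ∑ i, (![-x0, -x1] : Fin 2 → ℝ) i • ![A1, A2] i = B + (x0 • A1 + x1 • A2) := by
      simp [Fin.sum_univ_two]
      abel
    have := hmaxrank ![-x0, -x1] (by rw [e]; exact hBpsd.add hpsd)
    rwa [e] at this
  obtain ⟨T, hT, hTB, hstd⟩ := exists_isUnit_standardForm_of_gap (A2 := c 0 • A1 + c 1 • A2)
    (w := w) hpsd ((hA1.smul _).add (hA2.smul _)) hne hrn hB hBpsd hrank hw hcpos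
    (fun y1 y2 hy => by
      have := hP' (y1 * x0 + y2 * c 0) (y1 * x1 + y2 * c 1) (by
        convert hy using 2
        module)
      linear_combination this - y1 * hcx)
    (fun Y hY h1 h2 => by
      simp only [add_mul, smul_mul_assoc, trace_add, trace_smul, smul_eq_mul] at h1 h2
      refine hD Y hY (mul_left_cancel₀ hdet ?_) (mul_left_cancel₀ hdet ?_)
      · linear_combination c 1 * h1 - x1 * h2 - c 1 * hcx
      · linear_combination x0 * h2 - c 0 * h1 + c 0 * hcx)
  refine ⟨_, _, B, _, ⟨T, !![x0, x1; c 0, c 1], 0, hT, ?_, ?_, ?_, ?_⟩, hstd, rfl⟩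
  · rw [isUnit_iff_isUnit_det, det_fin_two_of]
    exact hdet.isUnit
  · intro i
    fin_cases i <;> simp [Fin.sum_univ_two]
  · ext i
    fin_cases i <;> simp [mulVec, dotProduct, Fin.sum_univ_two]
    linear_combination -hcx
  · simpa using hTB.symm
end

section
/- Suppose m = 2, the primal SDP (P) is feasible, and val(P) < val(D). Then (P) attains its optimal value (there is a feasible x with c·x = val(P)), and if (D) is feasible then (D) also attains its optimal value (there is a feasible positive semidefinite Y with trace(BY) = val(D)). -/
open Matrix

namespace Matrix

variable {n : Type*} [Fintype n]

lemma trace_mul_vecMulVec_self (M : Matrix n n ℝ) (v : n → ℝ) :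
    (M * vecMulVec v v).trace = v ⬝ᵥ M *ᵥ v := by
  rw [mul_vecMulVec, trace_vecMulVec, dotProduct_comm]

lemma posSemidef_vecMulVec_self (v : n → ℝ) : (vecMulVec v v).PosSemidef := by
  simpa using posSemidef_vecMulVec_self_star v

lemma posSemidef_of_isSymm {M : Matrix n n ℝ} (hM : M.IsSymm)
    (h : ∀ v, 0 ≤ v ⬝ᵥ M *ᵥ v) : M.PosSemidef :=
  .of_dotProduct_mulVec_nonneg (by rwa [IsHermitian, conjTranspose_eq_transpose_of_trivial])
    (by simpa using h)

namespace PosSemidef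

variable {M N : Matrix n n ℝ}

omit [Fintype n] in
lemma isSymm (hM : M.PosSemidef) : M.IsSymm := by
  simpa [IsSymm, IsHermitian, conjTranspose_eq_transpose_of_trivial] using hM.1

lemma quadForm_nonneg (hM : M.PosSemidef) (v : n → ℝ) : 0 ≤ v ⬝ᵥ M *ᵥ v := by
  simpa using hM.dotProduct_mulVec_nonneg v

lemma mulVec_eq_zero_of_quadForm (hM : M.PosSemidef) {v : n → ℝ} (h : v ⬝ᵥ M *ᵥ v = 0) :
    M *ᵥ v = 0 :=
  (hM.dotProduct_mulVec_zero_iff v).1 (by simpa using h)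

lemma exists_eq_transpose_mul_self (hM : M.PosSemidef) : ∃ R : Matrix n n ℝ, M = Rᵀ * R := by
  classical
  open scoped MatrixOrder in
  obtain ⟨R, hR⟩ := CStarAlgebra.nonneg_iff_eq_star_mul_self.mp hM.nonneg
  exact ⟨R, by rw [hR, star_eq_conjTranspose, conjTranspose_eq_transpose_of_trivial]⟩

lemma transpose_mul_mul_same (hM : M.PosSemidef) (E : Matrix n n ℝ) : (Eᵀ * M * E).PosSemidef := by
  simpa [conjTranspose_eq_transpose_of_trivial] using hM.conjTranspose_mul_mul_same E

lemma mul_mul_transpose_same (hM : M.PosSemidef) (E : Matrix n n ℝ) : (E * M * Eᵀ).PosSemidef := by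
  simpa [conjTranspose_eq_transpose_of_trivial] using hM.mul_mul_conjTranspose_same E

lemma trace_mul_nonneg (hM : M.PosSemidef) (hN : N.PosSemidef) : 0 ≤ (M * N).trace := by
  obtain ⟨R, rfl⟩ := hN.exists_eq_transpose_mul_self
  rw [← mul_assoc, trace_mul_comm, ← mul_assoc]
  exact (hM.mul_mul_transpose_same R).trace_nonneg

lemma mul_eq_zero_of_trace_mul (hM : M.PosSemidef) (hN : N.PosSemidef)
    (h : (M * N).trace = 0) : M * N = 0 := by
  obtain ⟨R, rfl⟩ := hN.exists_eq_transpose_mul_self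
  obtain ⟨G, rfl⟩ := hM.exists_eq_transpose_mul_self
  have h0 : (G * Rᵀ)ᴴ * (G * Rᵀ) = 0 := by
    rw [conjTranspose_mul_self_eq_zero, ← trace_conjTranspose_mul_self_eq_zero_iff, ← h]
    rw [conjTranspose_eq_transpose_of_trivial, transpose_mul, transpose_transpose,
      mul_assoc, trace_mul_comm]
    simp only [mul_assoc]
  rw [conjTranspose_mul_self_eq_zero] at h0
  rw [mul_assoc, ← mul_assoc G, h0]
  simp

lemma abs_apply_le_trace (hM : M.PosSemidef) (i j : n) : |M i j| ≤ M.trace := by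
  classical
  have hs : M j i = M i j := congrFun (congrFun hM.isSymm i) j
  have hd : ∀ k, M k k ≤ M.trace := fun k =>
    Finset.single_le_sum (f := fun k => M k k) (fun _ _ => hM.diag_nonneg) (Finset.mem_univ k)
  have h1 := hM.quadForm_nonneg (Pi.single i 1 + Pi.single j 1)
  have h2 := hM.quadForm_nonneg (Pi.single i 1 - Pi.single j 1)
  simp [mulVec_add, mulVec_sub] at h1 h2
  have := hd i
  have := hd j
  rw [abs_le]
  constructor <;> linarith

lemma mulVec_eq_zero_of_add (hM : M.PosSemidef) (hN : N.PosSemidef) {v : n → ℝ}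
    (h : (M + N) *ᵥ v = 0) : M *ᵥ v = 0 ∧ N *ᵥ v = 0 := by
  have h0 : v ⬝ᵥ M *ᵥ v + v ⬝ᵥ N *ᵥ v = 0 := by
    rw [← dotProduct_add, ← add_mulVec, h, dotProduct_zero]
  have h1 := hM.quadForm_nonneg v
  have h2 := hN.quadForm_nonneg v
  exact ⟨hM.mulVec_eq_zero_of_quadForm (by linarith), hN.mulVec_eq_zero_of_quadForm (by linarith)⟩

end PosSemidef

lemma isClosed_setOf_posSemidef : IsClosed {M : Matrix n n ℝ | M.PosSemidef} := by
  simp only [posSemidef_iff_dotProduct_mulVec, IsHermitian, Set.ofPred_and, Set.ofPred_forall]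
  refine (isClosed_eq (by fun_prop) (by fun_prop)).inter (isClosed_iInter fun v => ?_)
  exact isClosed_le (by fun_prop) (by fun_prop)

lemma isCompact_setOf_posSemidef_trace_le (r : ℝ) :
    IsCompact {M : Matrix n n ℝ | M.PosSemidef ∧ M.trace ≤ r} := by
  have hK : IsCompact (Set.univ.pi fun _ : n => Set.univ.pi fun _ : n => Set.Icc (-r) r) :=
    isCompact_univ_pi fun _ => isCompact_univ_pi fun _ => isCompact_Icc
  refine hK.of_isClosed_subset
    (isClosed_setOf_posSemidef.inter (isClosed_le (f := trace) (by fun_prop) continuous_const)) ?_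
  rintro M ⟨hM, hr⟩ i - j -
  exact abs_le.1 ((hM.abs_apply_le_trace i j).trans hr)

/-- A matrix whose linear map is a projection onto the kernel of `M`. -/
lemma exists_projection_ker [DecidableEq n] (M : Matrix n n ℝ) :
    ∃ F : Matrix n n ℝ, M * F = 0 ∧ ∀ N : Matrix n n ℝ, M * N = 0 → F * N = N := by
  obtain ⟨f, hf⟩ := (LinearMap.ker M.toLin').subtype.exists_leftInverse_of_injective
    (LinearMap.ker M.toLin').ker_subtype
  refine ⟨LinearMap.toMatrix' ((LinearMap.ker M.toLin').subtype ∘ₗ f), ?_, fun N hN => ?_⟩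
  · apply Matrix.toLin'.injective
    rw [toLin'_mul, toLin'_toMatrix']
    refine LinearMap.ext fun v => ?_
    simp
  · refine ext_of_mulVec_single fun j => ?_
    have hv : N *ᵥ Pi.single j 1 ∈ LinearMap.ker M.toLin' := by
      rw [LinearMap.mem_ker, toLin'_apply, mulVec_mulVec, hN, zero_mulVec]
    have := congrArg Subtype.val (LinearMap.congr_fun hf ⟨_, hv⟩)
    rw [← mulVec_mulVec, ← toLin'_apply, toLin'_toMatrix']
    simpa using this

lemma mul_eq_zero_of_mulVec_ker {S M N : Matrix n n ℝ} (h : ∀ v, S *ᵥ v = 0 → M *ᵥ v = 0)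
    (hN : S * N = 0) : M * N = 0 := by
  classical
  refine ext_of_mulVec_single fun j => ?_
  rw [← mulVec_mulVec, h _ (by rw [mulVec_mulVec, hN, zero_mulVec]), zero_mulVec]

/-- Strong duality with dual attainment, for slack `S` whose kernel lies in the kernel of every
constraint matrix: if `p > 0` bounds the primal objective, the dual has a feasible point of
value at most `p`. -/
theorem exists_dual_trace_le {ι : Type*} [Fintype ι] (A : ι → Matrix n n ℝ) (S : Matrix n n ℝ)
    (c : ι → ℝ) (hA : ∀ i, (A i).IsSymm) (hS : S.PosSemidef)
    (hker : ∀ v, S *ᵥ v = 0 → ∀ i, A i *ᵥ v = 0) {p : ℝ} (hp : 0 < p)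
    (hbound : ∀ x : ι → ℝ, (S - ∑ i, x i • A i).PosSemidef → ∑ i, c i * x i ≤ p) :
    ∃ Y : Matrix n n ℝ, Y.PosSemidef ∧ (∀ i, (A i * Y).trace = c i) ∧ (S * Y).trace ≤ p := by
  classical
  obtain ⟨F, hSF, hF⟩ := S.exists_projection_ker
  have hFF : F * F = F := hF F hSF
  have hAF : ∀ i, A i * F = 0 := fun i =>
    mul_eq_zero_of_mulVec_ker (fun v hv => hker v hv i) hSF
  have hFtF : (Fᵀ * F).PosSemidef := by
    simpa using PosSemidef.one.transpose_mul_mul_same F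
  have hP : (S + Fᵀ * F).PosSemidef := hS.add hFtF
  obtain ⟨R, hR⟩ := hP.exists_eq_transpose_mul_self
  have hRunit : IsUnit R := by
    rw [← mulVec_injective_iff_isUnit]
    refine (injective_iff_map_eq_zero R.mulVecLin).2 fun v hv => ?_
    have hPv : (S + Fᵀ * F) *ᵥ v = 0 := by
      rw [hR, ← mulVec_mulVec, ← mulVecLin_apply R, hv, mulVec_zero]
    obtain ⟨h3, h4⟩ := hS.mulVec_eq_zero_of_add hFtF hPv
    replace h4 : F *ᵥ v = 0 := by
      have : v ⬝ᵥ (Fᵀ * F) *ᵥ v = 0 := by rw [h4, dotProduct_zero]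
      rwa [← mulVec_mulVec, dotProduct_mulVec, vecMul_transpose, dotProduct_self_eq_zero] at this
    have h5 : F * vecMulVec v v = vecMulVec v v := hF _ (by rw [mul_vecMulVec, h3, zero_vecMulVec])
    rw [mul_vecMulVec, h4, zero_vecMulVec] at h5
    have h6 := congrArg trace h5
    rwa [trace_vecMulVec, trace_zero, eq_comm, dotProduct_self_eq_zero] at h6
  have hRdet := (isUnit_iff_isUnit_det R).1 hRunit
  let Φ : Matrix n n ℝ → ι → ℝ := fun Z i => (A i * (R⁻¹ * Z * R⁻¹ᵀ)).trace
  let C := Φ '' {Z | Z.PosSemidef ∧ Z.trace ≤ p}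
  have hΦ : Continuous Φ := by fun_prop
  have hΦlin : ∀ (a b : ℝ) (Z W : Matrix n n ℝ), Φ (a • Z + b • W) = a • Φ Z + b • Φ W := by
    intro a b Z W
    ext i
    simp [Φ, mul_add, add_mul]
  have hC : IsCompact C := (isCompact_setOf_posSemidef_trace_le p).image hΦ
  have hCconv : Convex ℝ C := by
    rintro _ ⟨Z, ⟨hZ, hZp⟩, rfl⟩ _ ⟨W, ⟨hW, hWp⟩, rfl⟩ a b ha hb hab
    refine ⟨a • Z + b • W, ⟨(hZ.smul ha).add (hW.smul hb), ?_⟩, hΦlin a b Z W⟩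
    simp only [trace_add, trace_smul, smul_eq_mul]
    calc a * Z.trace + b * W.trace ≤ a * p + b * p := by gcongr
      _ = p := by rw [← add_mul, hab, one_mul]
  have hmemC : ∀ Y : Matrix n n ℝ, Y.PosSemidef → ((S + Fᵀ * F) * Y).trace ≤ p →
      (fun i => (A i * Y).trace) ∈ C := by
    intro Y hY hYp
    refine ⟨R * Y * Rᵀ, ⟨hY.mul_mul_transpose_same R, ?_⟩, ?_⟩
    · rw [trace_mul_comm, ← mul_assoc, ← hR]
      exact hYp
    · have : R⁻¹ * (R * Y * Rᵀ) * R⁻¹ᵀ = Y := by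
        rw [mul_assoc R, ← mul_assoc, nonsing_inv_mul _ hRdet, one_mul, mul_assoc, ← transpose_mul,
          nonsing_inv_mul _ hRdet, transpose_one, mul_one]
      simp only [Φ, this]
  by_cases hc : c ∈ C
  · obtain ⟨Z, ⟨hZ, hZp⟩, hZc⟩ := hc
    refine ⟨_, hZ.mul_mul_transpose_same R⁻¹, fun i => congrFun hZc i, ?_⟩
    have h1 : ((S + Fᵀ * F) * (R⁻¹ * Z * R⁻¹ᵀ)).trace = Z.trace := by
      rw [hR, mul_assoc R⁻¹, ← mul_assoc, mul_assoc Rᵀ, mul_nonsing_inv _ hRdet, mul_one,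
        trace_mul_comm, mul_assoc, ← transpose_mul, mul_nonsing_inv _ hRdet, transpose_one, mul_one]
    have h2 := hFtF.trace_mul_nonneg (hZ.mul_mul_transpose_same R⁻¹)
    rw [add_mul, trace_add] at h1
    linarith
  · exfalso
    obtain ⟨f, u, hfC, hfc⟩ := geometric_hahn_banach_closed_point hCconv hC.isClosed hc
    have hf : ∀ a : ι → ℝ, f a = ∑ i, a i * f (Pi.single i 1) := fun a => by
      have := LinearMap.pi_apply_eq_sum_univ f.toLinearMap a
      simp only [smul_eq_mul, ContinuousLinearMap.coe_coe] at this
      rw [this]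
      refine Finset.sum_congr rfl fun i _ => ?_
      congr 2
      ext j
      simp [Pi.single_apply, eq_comm]
    have hu : 0 < u := by
      have := hfC _ (hmemC 0 .zero (by simpa using hp.le))
      simpa [← Pi.zero_def] using this
    set x : ι → ℝ := fun i => p / u * f (Pi.single i 1) with hx
    have hfx : ∀ a : ι → ℝ, ∑ i, a i * x i = p / u * f a := fun a => by
      rw [hf, Finset.mul_sum]
      exact Finset.sum_congr rfl fun i _ => by rw [hx]; ring
    set T := S - ∑ i, x i • A i with hT
    have hTsymm : T.IsSymm := by
      simp only [hT, IsSymm, transpose_sub, transpose_sum, transpose_smul, hS.isSymm.eq, (hA _).eq]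
    have hTF : T * F = 0 := by
      simp [hT, sub_mul, Finset.sum_mul, hSF, hAF]
    have hTproj : T = (1 - F)ᵀ * T * (1 - F) := by
      have : Fᵀ * T = 0 := by
        rw [← hTsymm.eq, ← transpose_mul, hTF, transpose_zero]
      simp [sub_mul, mul_sub, this, hTF]
    have hTpos : T.PosSemidef := by
      refine posSemidef_of_isSymm hTsymm fun v => ?_
      set w := (1 - F) *ᵥ v with hw
      have hFw : F *ᵥ w = 0 := by
        rw [hw, mulVec_mulVec, mul_sub, mul_one, hFF, sub_self, zero_mulVec]
      have hvw : v ⬝ᵥ T *ᵥ v = w ⬝ᵥ T *ᵥ w := by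
        conv_lhs => rw [hTproj]
        rw [← mulVec_mulVec, ← mulVec_mulVec, dotProduct_mulVec, vecMul_transpose]
      rw [hvw]
      have hwT : w ⬝ᵥ T *ᵥ w = w ⬝ᵥ S *ᵥ w - p / u * f (fun i => w ⬝ᵥ A i *ᵥ w) := by
        rw [← hfx, hT, sub_mulVec, dotProduct_sub, sum_mulVec, dotProduct_sum]
        simp [smul_mulVec, mul_comm]
      rcases (hS.quadForm_nonneg w).eq_or_lt with h0 | hpos
      · have hSw := hS.mulVec_eq_zero_of_quadForm h0.symm
        rw [hwT, hSw]
        simp [hker w hSw, ← Pi.zero_def]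
      · have hmem := hfC _ (hmemC ((p / (w ⬝ᵥ S *ᵥ w)) • vecMulVec w w)
          ((posSemidef_vecMulVec_self w).smul (by positivity)) (le_of_eq (by
            rw [Matrix.mul_smul, trace_smul, trace_mul_vecMulVec_self, add_mulVec, ← mulVec_mulVec, hFw,
              mulVec_zero, add_zero, smul_eq_mul, div_mul_cancel₀ _ hpos.ne'])))
        have hval : (fun i => (A i * ((p / (w ⬝ᵥ S *ᵥ w)) • vecMulVec w w)).trace) =
            (p / (w ⬝ᵥ S *ᵥ w)) • fun i => w ⬝ᵥ A i *ᵥ w := by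
          ext i
          rw [Matrix.mul_smul, trace_smul, trace_mul_vecMulVec_self, Pi.smul_apply]
        rw [hval, map_smul, smul_eq_mul, div_mul_eq_mul_div, div_lt_iff₀ hpos] at hmem
        rw [hwT, sub_nonneg, div_mul_eq_mul_div, div_le_iff₀ hu]
        linarith
    have h1 := hbound x hTpos
    rw [hfx, div_mul_eq_mul_div, div_le_iff₀ hu] at h1
    exact absurd (lt_of_mul_lt_mul_left (h1.trans_lt' (mul_lt_mul_of_pos_left hfc hp)) hp.le)
      (lt_irrefl _)

/-- Version of `exists_dual_trace_le` based at an arbitrary feasible point `x₀`. -/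
theorem exists_dual_trace_le_of_feasible {ι : Type*} [Fintype ι] (A : ι → Matrix n n ℝ)
    (B : Matrix n n ℝ) (c : ι → ℝ) (hA : ∀ i, (A i).IsSymm) {x₀ : ι → ℝ}
    (hx₀ : (B - ∑ i, x₀ i • A i).PosSemidef)
    (hker : ∀ v, (B - ∑ i, x₀ i • A i) *ᵥ v = 0 → ∀ i, A i *ᵥ v = 0) {p : ℝ}
    (hp : ∑ i, c i * x₀ i < p)
    (hbound : ∀ x : ι → ℝ, (B - ∑ i, x i • A i).PosSemidef → ∑ i, c i * x i ≤ p) :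
    ∃ Y : Matrix n n ℝ, Y.PosSemidef ∧ (∀ i, (A i * Y).trace = c i) ∧ (B * Y).trace ≤ p := by
  obtain ⟨Y, hY, hYc, hYp⟩ := exists_dual_trace_le A _ c hA hx₀ hker (sub_pos.2 hp)
    (fun x hx => by
      have := hbound (x₀ + x) (by
        simpa [add_smul, Finset.sum_add_distrib, sub_sub] using hx)
      simp only [Pi.add_apply, mul_add, Finset.sum_add_distrib] at this
      linarith)
  refine ⟨Y, hY, hYc, ?_⟩
  have h : ((B - ∑ i, x₀ i • A i) * Y).trace = (B * Y).trace - ∑ i, c i * x₀ i := by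
    simp [sub_mul, Finset.sum_mul, trace_sum, hYc, mul_comm]
  rw [h] at hYp
  linarith

end Matrix

section TwoVariables

variable {n : ℕ} {A : Fin 2 → Matrix (Fin n) (Fin n) ℝ} {B : Matrix (Fin n) (Fin n) ℝ}
  {c : Fin 2 → ℝ}

/-- If the primal feasible set contains three affinely independent points, every value strictly
above the primal optimum is matched by the dual. -/
lemma exists_dual_trace_le_of_affineIndependent (hA : ∀ i, (A i).IsSymm) {x y z : Fin 2 → ℝ}
    (hx : (B - ∑ i, x i • A i).PosSemidef) (hy : (B - ∑ i, y i • A i).PosSemidef)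
    (hz : (B - ∑ i, z i • A i).PosSemidef)
    (hdet : (y 0 - x 0) * (z 1 - x 1) - (y 1 - x 1) * (z 0 - x 0) ≠ 0) {p : ℝ}
    (hbound : ∀ w : Fin 2 → ℝ, (B - ∑ i, w i • A i).PosSemidef → ∑ i, c i * w i < p) :
    ∃ Y : Matrix (Fin n) (Fin n) ℝ, Y.PosSemidef ∧ (∀ i, (A i * Y).trace = c i) ∧
      (B * Y).trace ≤ p := by
  have hcent : B - ∑ i, ((1 / 3 : ℝ) • (x + y + z)) i • A i = (1 / 3 : ℝ) •
      ((B - ∑ i, x i • A i) + (B - ∑ i, y i • A i) + (B - ∑ i, z i • A i)) := by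
    simp only [Fin.sum_univ_two, Pi.smul_apply, Pi.add_apply, smul_eq_mul]
    module
  have hfeas : (B - ∑ i, ((1 / 3 : ℝ) • (x + y + z)) i • A i).PosSemidef := by
    rw [hcent]
    exact ((hx.add hy).add hz).smul (by norm_num)
  refine Matrix.exists_dual_trace_le_of_feasible A B c hA hfeas (fun v hv => ?_)
    (hbound _ hfeas) fun w hw => (hbound w hw).le
  rw [hcent, smul_mulVec, smul_eq_zero_iff_right (by norm_num)] at hv
  obtain ⟨hxy, hvz⟩ := (hx.add hy).mulVec_eq_zero_of_add hz hv
  obtain ⟨hvx, hvy⟩ := hx.mulVec_eq_zero_of_add hy hxy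
  simp only [Fin.sum_univ_two, sub_mulVec, add_mulVec, smul_mulVec, sub_eq_zero] at hvx hvy hvz
  have h1 : (y 0 - x 0) • (A 0 *ᵥ v) + (y 1 - x 1) • (A 1 *ᵥ v) = 0 := by
    linear_combination (norm := module) hvx - hvy
  have h2 : (z 0 - x 0) • (A 0 *ᵥ v) + (z 1 - x 1) • (A 1 *ᵥ v) = 0 := by
    linear_combination (norm := module) hvx - hvz
  have h3 : ((y 0 - x 0) * (z 1 - x 1) - (y 1 - x 1) * (z 0 - x 0)) • (A 0 *ᵥ v) = 0 := by
    linear_combination (norm := module) (z 1 - x 1) • h1 - (y 1 - x 1) • h2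
  have h4 : ((y 0 - x 0) * (z 1 - x 1) - (y 1 - x 1) * (z 0 - x 0)) • (A 1 *ᵥ v) = 0 := by
    linear_combination (norm := module) (y 0 - x 0) • h2 - (z 0 - x 0) • h1
  rw [Fin.forall_fin_two]
  exact ⟨(smul_eq_zero_iff_right hdet).1 h3, (smul_eq_zero_iff_right hdet).1 h4⟩

lemma primal_attained_of_gap (hA : ∀ i, (A i).IsSymm) (hB : B.IsSymm) {p p' : ℝ} (hpp' : p < p')
    (hle : ∀ x : Fin 2 → ℝ, (B - ∑ i, x i • A i).PosSemidef → ∑ i, c i * x i ≤ p)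
    (hsup : ∀ r < p, ∃ x : Fin 2 → ℝ, (B - ∑ i, x i • A i).PosSemidef ∧ r < ∑ i, c i * x i)
    (hdual : ∀ Y : Matrix (Fin n) (Fin n) ℝ, Y.PosSemidef → (∀ i, (A i * Y).trace = c i) →
      p' < (B * Y).trace) :
    ∃ x : Fin 2 → ℝ, (B - ∑ i, x i • A i).PosSemidef ∧ ∑ i, c i * x i = p := by
  by_contra! hne
  have hlt : ∀ x : Fin 2 → ℝ, (B - ∑ i, x i • A i).PosSemidef → ∑ i, c i * x i < p :=
    fun x hx => (hle x hx).lt_of_ne (hne x hx)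
  obtain ⟨x, hx, -⟩ := hsup (p - 1) (by linarith)
  obtain ⟨y, hy, hxy⟩ := hsup _ (hlt x hx)
  set k := ∑ i, c i * y i - ∑ i, c i * x i with hk
  have hkpos : 0 < k := sub_pos.2 hxy
  set D := ∑ i, (y i - x i) • A i with hD
  have hline : ∀ z : Fin 2 → ℝ, (B - ∑ i, z i • A i).PosSemidef →
      B - ∑ i, z i • A i =
        B - ∑ i, x i • A i - ((∑ i, c i * z i - ∑ i, c i * x i) / k) • D := by
    intro z hz
    have hdet : (y 0 - x 0) * (z 1 - x 1) - (y 1 - x 1) * (z 0 - x 0) = 0 := by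
      by_contra hdet
      obtain ⟨Y, hY, hYc, hYp⟩ := exists_dual_trace_le_of_affineIndependent hA hx hy hz hdet
        fun w hw => (hlt w hw).trans hpp'
      exact absurd hYp (hdual Y hY hYc).not_ge
    have hcoord : ∀ i, z i = x i + (∑ i, c i * z i - ∑ i, c i * x i) / k * (y i - x i) := by
      simp only [Fin.sum_univ_two] at hk ⊢
      rw [Fin.forall_fin_two]
      constructor <;> rw [← sub_eq_iff_eq_add', div_mul_eq_mul_div, eq_div_iff hkpos.ne', hk]
      · linear_combination -c 1 * hdet
      · linear_combination c 0 * hdet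
    rw [sub_sub, hD, Finset.smul_sum, ← Finset.sum_add_distrib]
    congr 1
    refine Finset.sum_congr rfl fun i _ => ?_
    conv_lhs => rw [hcoord i]
    rw [add_smul, mul_smul]
  set τ := (p - ∑ i, c i * x i) / k with hτ
  have hτpos : 0 < τ := div_pos (sub_pos.2 (hlt x hx)) hkpos
  have hstar : B - ∑ i, (x i + τ * (y i - x i)) • A i = B - ∑ i, x i • A i - τ • D := by
    simp only [hD, Fin.sum_univ_two]
    module
  refine hne (fun i => x i + τ * (y i - x i)) ?_ ?_
  · refine Matrix.posSemidef_of_isSymm ?_ fun v => ?_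
    · simp only [Matrix.IsSymm, transpose_sub, transpose_sum, transpose_smul, hB.eq, (hA _).eq]
    rw [hstar, sub_mulVec, smul_mulVec, dotProduct_sub, dotProduct_smul, smul_eq_mul]
    have hv := hx.quadForm_nonneg v
    set a := v ⬝ᵥ (B - ∑ i, x i • A i) *ᵥ v
    set b := v ⬝ᵥ D *ᵥ v
    by_contra! hneg
    have hb : 0 < b := by
      by_contra! hb
      nlinarith
    obtain ⟨z, hz, hzp⟩ := hsup (∑ i, c i * x i + a / b * k) (by
      rw [← lt_sub_iff_add_lt', ← lt_div_iff₀ hkpos, ← hτ, div_lt_iff₀ hb]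
      linarith)
    have hzv := hz.quadForm_nonneg v
    rw [hline z hz, sub_mulVec, smul_mulVec, dotProduct_sub, dotProduct_smul, smul_eq_mul] at hzv
    rw [← lt_sub_iff_add_lt', ← lt_div_iff₀ hkpos, div_lt_iff₀ hb] at hzp
    linarith
  · have h1 : ∑ i, c i * (x i + τ * (y i - x i)) = ∑ i, c i * x i + τ * k := by
      simp only [hk, Fin.sum_univ_two]
      ring
    rw [h1, hτ, div_mul_cancel₀ _ hkpos.ne']
    ring

/-- For a single constraint, dual attainment holds as soon as some primal feasible value is
strictly below the dual optimal value `q`. -/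
lemma exists_dual_trace_le_of_single_constraint {A' B' : Matrix (Fin n) (Fin n) ℝ}
    (hA' : A'.IsSymm) {t q : ℝ} (htq : t < q) (ht : (B' - t • A').PosSemidef)
    (hq : (B' - q • A').PosSemidef) (hbound : ∀ r, (B' - r • A').PosSemidef → r ≤ q) :
    ∃ Y : Matrix (Fin n) (Fin n) ℝ, Y.PosSemidef ∧ (A' * Y).trace = 1 ∧ (B' * Y).trace ≤ q := by
  have hmid : B' - ((t + q) / 2) • A' =
      (1 / 2 : ℝ) • ((B' - t • A') + (B' - q • A')) := by module
  obtain ⟨Y, hY, hYA, hYB⟩ := Matrix.exists_dual_trace_le_of_feasible (ι := Unit)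
    (fun _ => A') B' (fun _ => 1) (fun _ => hA') (x₀ := fun _ => (t + q) / 2) (p := q)
    (by
      rw [Fintype.sum_unique, hmid]
      exact (ht.add hq).smul (by norm_num))
    (fun v hv _ => by
      rw [Fintype.sum_unique, hmid, smul_mulVec, smul_eq_zero_iff_right (by norm_num)] at hv
      obtain ⟨h1, h2⟩ := ht.mulVec_eq_zero_of_add hq hv
      simp only [sub_mulVec, smul_mulVec] at h1 h2
      have h3 : (q - t) • (A' *ᵥ v) = 0 := by
        linear_combination (norm := module) h1 - h2
      exact (smul_eq_zero_iff_right (sub_pos.2 htq).ne').1 h3)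
    (by simp; linarith) (fun x hx => by simpa using hbound (x ()) (by simpa using hx))
  exact ⟨Y, hY, hYA (), hYB⟩

lemma dual_attained_of_gap (hA : ∀ i, (A i).IsSymm) (hB : B.IsSymm) {q : ℝ}
    (hfeas : ∃ x : Fin 2 → ℝ, (B - ∑ i, x i • A i).PosSemidef)
    (hgap : ∀ x : Fin 2 → ℝ, (B - ∑ i, x i • A i).PosSemidef → ∑ i, c i * x i < q)
    (hge : ∀ Y : Matrix (Fin n) (Fin n) ℝ, Y.PosSemidef → (∀ i, (A i * Y).trace = c i) →
      q ≤ (B * Y).trace)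
    (hinf : ∀ r > q, ∃ Y : Matrix (Fin n) (Fin n) ℝ, Y.PosSemidef ∧
      (∀ i, (A i * Y).trace = c i) ∧ (B * Y).trace < r) :
    ∃ Y : Matrix (Fin n) (Fin n) ℝ, Y.PosSemidef ∧ (∀ i, (A i * Y).trace = c i) ∧
      (B * Y).trace ≤ q := by
  obtain ⟨x₀, hx₀⟩ := hfeas
  have hN : 0 < c 0 ^ 2 + c 1 ^ 2 := by
    by_contra! h
    have h0 : c 0 = 0 := by nlinarith [sq_nonneg (c 0), sq_nonneg (c 1)]
    have h1 : c 1 = 0 := by nlinarith [sq_nonneg (c 0), sq_nonneg (c 1)]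
    have h2 := hge 0 .zero (by simp [Fin.forall_fin_two, h0, h1])
    have h3 := hgap x₀ hx₀
    simp [h0, h1] at h2 h3
    linarith
  set N := c 0 ^ 2 + c 1 ^ 2 with hNdef
  set P := (-c 1) • A 0 + c 0 • A 1 with hP
  set Q := (c 0 / N) • A 0 + (c 1 / N) • A 1 with hQ
  have hA0 : A 0 = c 0 • Q - (c 1 / N) • P := by
    rw [hP, hQ]
    match_scalars <;> field_simp <;> simp [hNdef]
  have hA1 : A 1 = c 1 • Q + (c 0 / N) • P := by
    rw [hP, hQ]
    match_scalars <;> field_simp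
    · ring
    · simp [hNdef]
  have hPsymm : P.IsSymm := by
    simp [hP, Matrix.IsSymm, (hA _).eq]
  have hQsymm : Q.IsSymm := by
    simp [hQ, Matrix.IsSymm, (hA _).eq]
  have hdual : ∀ Y : Matrix (Fin n) (Fin n) ℝ, (P * Y).trace = 0 → (Q * Y).trace = 1 →
      ∀ i, (A i * Y).trace = c i := by
    intro Y h1 h2
    rw [Fin.forall_fin_two]
    constructor
    · rw [hA0]
      simp [sub_mul, h1, h2]
    · rw [hA1]
      simp [add_mul, h1, h2]
  have hdualP : ∀ Y : Matrix (Fin n) (Fin n) ℝ, (∀ i, (A i * Y).trace = c i) →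
      (P * Y).trace = 0 := by
    intro Y h
    simp [hP, add_mul, h]
    ring
  have hdualQ : ∀ Y : Matrix (Fin n) (Fin n) ℝ, (∀ i, (A i * Y).trace = c i) →
      (Q * Y).trace = 1 := by
    intro Y h
    simp [hQ, add_mul, h]
    field_simp
    exact hNdef.symm
  have hcone : ∀ Z : Matrix (Fin n) (Fin n) ℝ, Z.PosSemidef → (P * Z).trace = 0 →
      q * (Q * Z).trace ≤ (B * Z).trace := by
    intro Z hZ hPZ
    by_contra! hlt
    set α := (Q * Z).trace
    have hden : 0 < 1 + |α| := by positivity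
    obtain ⟨s, hs, hsα⟩ : ∃ s : ℝ, 0 < s ∧ |s * α| ≤ 1 := by
      refine ⟨1 / (1 + |α|), by positivity, ?_⟩
      rw [abs_mul, abs_of_pos (by positivity), div_mul_eq_mul_div, div_le_one hden]
      linarith
    obtain ⟨hsα1, hsα2⟩ := abs_le.1 hsα
    have hδ : 0 < s * (q * α - (B * Z).trace) := mul_pos hs (sub_pos.2 hlt)
    obtain ⟨Y, hY, hYc, hYq⟩ := hinf (q + s * (q * α - (B * Z).trace) / 2) (by linarith)
    have h1 := hge (s • Z + (1 - s * α) • Y)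
      ((hZ.smul hs.le).add (hY.smul (by linarith)))
      (hdual _ (by simp [mul_add, hPZ, hdualP Y hYc]) (by
        simp only [mul_add, trace_add, Matrix.mul_smul, trace_smul, hdualQ Y hYc, smul_eq_mul]
        ring))
    simp only [mul_add, trace_add, Matrix.mul_smul, trace_smul, smul_eq_mul] at h1
    nlinarith [hge Y hY hYc]
  -- `P` cannot be indefinite: a separating multiplier would close the gap.
  have hsemidef : P.PosSemidef ∨ (-P).PosSemidef := by
    by_contra! hindef
    obtain ⟨hpos, hneg⟩ := hindef
    have hv : ∃ v, v ⬝ᵥ P *ᵥ v < 0 := by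
      by_contra! h
      exact hpos (Matrix.posSemidef_of_isSymm hPsymm h)
    have hw : ∃ w, 0 < w ⬝ᵥ P *ᵥ w := by
      by_contra! h
      exact hneg (Matrix.posSemidef_of_isSymm (by simpa [Matrix.IsSymm] using hPsymm.eq)
        fun v => by simpa [neg_mulVec] using h v)
    obtain ⟨v₀, hv₀⟩ := hv
    obtain ⟨w₀, hw₀⟩ := hw
    let g : (Fin n → ℝ) → ℝ := fun v => v ⬝ᵥ (B - q • Q) *ᵥ v
    let β : (Fin n → ℝ) → ℝ := fun v => v ⬝ᵥ P *ᵥ v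
    obtain ⟨s, hs1, hs2⟩ := exists_between_of_forall_le
      (s := (fun v => g v / β v) '' {v | β v < 0}) (t := (fun v => g v / β v) '' {v | 0 < β v})
      ⟨_, v₀, hv₀, rfl⟩ ⟨_, w₀, hw₀, rfl⟩ (by
        rintro _ ⟨v, hv, rfl⟩ _ ⟨w, hw, rfl⟩
        have hv : β v < 0 := hv
        have hw : 0 < β w := hw
        have h := hcone (β w • vecMulVec v v + (-β v) • vecMulVec w w)
          (((Matrix.posSemidef_vecMulVec_self v).smul hw.le).add
            ((Matrix.posSemidef_vecMulVec_self w).smul (neg_pos.2 hv).le)) (by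
          simp only [mul_add, Matrix.mul_smul, trace_add, trace_smul,
            Matrix.trace_mul_vecMulVec_self, smul_eq_mul]
          change β w * β v + -β v * β w = 0
          ring)
        simp only [mul_add, Matrix.mul_smul, trace_add, trace_smul,
          Matrix.trace_mul_vecMulVec_self, smul_eq_mul] at h
        have hgv : ∀ u, g u = u ⬝ᵥ B *ᵥ u - q * (u ⬝ᵥ Q *ᵥ u) := fun u => by
          simp [g, sub_mulVec, smul_mulVec]
        change g v / β v ≤ g w / β w
        rw [le_div_iff₀ hw, div_mul_eq_mul_div, div_le_iff_of_neg hv, hgv, hgv]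
        linarith)
    have hM : B - ∑ i, ![q * (c 0 / N) - s * c 1, q * (c 1 / N) + s * c 0] i • A i =
        B - q • Q - s • P := by
      simp only [Fin.sum_univ_two, hP, hQ, Matrix.cons_val_zero, Matrix.cons_val_one]
      module
    refine absurd (hgap ![q * (c 0 / N) - s * c 1, q * (c 1 / N) + s * c 0] ?_) (not_lt.2 ?_)
    · rw [hM]
      refine Matrix.posSemidef_of_isSymm ?_ fun v => ?_
      · simp [Matrix.IsSymm, hB.eq, hQsymm.eq, hPsymm.eq]
      have hval : v ⬝ᵥ (B - q • Q - s • P) *ᵥ v = g v - s * β v := by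
        rw [sub_mulVec, dotProduct_sub, smul_mulVec, dotProduct_smul, smul_eq_mul]
      rw [hval, sub_nonneg]
      rcases lt_trichotomy (β v) 0 with h | h | h
      · exact (div_le_iff_of_neg h).1 (hs1 ⟨v, h, rfl⟩)
      · have := hcone _ (Matrix.posSemidef_vecMulVec_self v)
          (by rw [Matrix.trace_mul_vecMulVec_self]; exact h)
        rw [Matrix.trace_mul_vecMulVec_self, Matrix.trace_mul_vecMulVec_self] at this
        simp only [h, mul_zero, g, sub_mulVec, smul_mulVec, dotProduct_sub, dotProduct_smul,
          smul_eq_mul]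
        linarith
      · exact (le_div_iff₀ h).1 (hs2 ⟨v, h, rfl⟩)
    · simp only [Fin.sum_univ_two, Matrix.cons_val_zero, Matrix.cons_val_one]
      have : c 0 * (q * (c 0 / N) - s * c 1) + c 1 * (q * (c 1 / N) + s * c 0) = q := by
        field_simp
        rw [hNdef]
        ring
      exact this.ge
  obtain ⟨E, hPE, hE⟩ := P.exists_projection_ker
  have hface : ∀ Y : Matrix (Fin n) (Fin n) ℝ, Y.PosSemidef → (P * Y).trace = 0 →
      E * Y * Eᵀ = Y := by
    intro Y hY hPY
    have hPY0 : P * Y = 0 := by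
      rcases hsemidef with h | h
      · exact h.mul_eq_zero_of_trace_mul hY hPY
      · simpa using h.mul_eq_zero_of_trace_mul hY (by simpa using hPY)
    have hEY := hE Y hPY0
    have hYE := congrArg transpose hEY
    rw [transpose_mul, hY.isSymm.eq] at hYE
    rw [hEY, hYE]
  have htrace : ∀ M Y : Matrix (Fin n) (Fin n) ℝ,
      (Eᵀ * M * E * Y).trace = (M * (E * Y * Eᵀ)).trace := by
    intro M Y
    rw [mul_assoc, mul_assoc, trace_mul_comm]
    simp only [mul_assoc]
  have hPtrace : ∀ Y : Matrix (Fin n) (Fin n) ℝ, (P * (E * Y * Eᵀ)).trace = 0 := by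
    intro Y
    rw [mul_assoc E, ← mul_assoc, hPE, zero_mul, trace_zero]
  have hcompress : ∀ r : ℝ, Eᵀ * B * E - r • (Eᵀ * Q * E) = Eᵀ * (B - r • Q) * E := by
    intro r
    simp [mul_sub, sub_mul]
  have hbase : (Eᵀ * B * E - (∑ i, c i * x₀ i) • (Eᵀ * Q * E)).PosSemidef := by
    have : Eᵀ * (B - (∑ i, c i * x₀ i) • Q) * E = Eᵀ * (B - ∑ i, x₀ i • A i) * E := by
      have h : B - ∑ i, x₀ i • A i =
          B - (∑ i, c i * x₀ i) • Q - ((c 0 * x₀ 1 - c 1 * x₀ 0) / N) • P := by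
        rw [Fin.sum_univ_two, Fin.sum_univ_two, hA0, hA1]
        module
      rw [h, mul_sub _ _ (_ • P), sub_mul _ (_ * (_ • P)), mul_assoc Eᵀ (_ • P), smul_mul, hPE]
      simp
    rw [hcompress, this]
    exact hx₀.transpose_mul_mul_same E
  have hcomp_symm : ∀ {M : Matrix (Fin n) (Fin n) ℝ}, M.IsSymm → (Eᵀ * M * E).IsSymm := by
    intro M hM
    simp [Matrix.IsSymm, transpose_mul, hM.eq, mul_assoc]
  obtain ⟨Y, hY, hYQ, hYB⟩ := exists_dual_trace_le_of_single_constraint (hcomp_symm hQsymm)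
    (hgap x₀ hx₀) hbase
    (by
      rw [hcompress]
      refine Matrix.posSemidef_of_isSymm
        (hcomp_symm (by simp [Matrix.IsSymm, hB.eq, hQsymm.eq])) fun v => ?_
      have h := hcone _ ((Matrix.posSemidef_vecMulVec_self v).mul_mul_transpose_same E)
        (hPtrace _)
      rw [← Matrix.trace_mul_vecMulVec_self, htrace, sub_mul, trace_sub, smul_mul, trace_smul,
        smul_eq_mul]
      linarith)
    (by
      intro r hr
      by_contra! hlt
      obtain ⟨Y, hY, hYc, hYr⟩ := hinf r hlt
      have h := hr.trace_mul_nonneg hY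
      rw [hcompress, htrace, hface Y hY (hdualP Y hYc), sub_mul, trace_sub, smul_mul, trace_smul,
        hdualQ Y hYc, smul_eq_mul] at h
      linarith)
  rw [htrace] at hYQ hYB
  exact ⟨_, hY.mul_mul_transpose_same E, hdual _ (hPtrace _) hYQ, hYB⟩

end TwoVariables

/-- If `m = 2`, the primal SDP (P) is feasible, and there is a positive duality gap
`val(P) < val(D)`, then (P) attains its optimal value, and so does (D) if it is
feasible. -/
theorem twoVar_gap_attainment {n : ℕ}
    (A : Fin 2 → Matrix (Fin n) (Fin n) ℝ) (B : Matrix (Fin n) (Fin n) ℝ)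
    (c : Fin 2 → ℝ)
    (hsymm : ∀ i, (A i).IsSymm) (hBsymm : B.IsSymm)
    (hfeas : ∃ x : Fin 2 → ℝ, (B - ∑ i, x i • A i).PosSemidef)
    (hgap : valP A B c < valD A B c) :
    (∃ x : Fin 2 → ℝ, (B - ∑ i, x i • A i).PosSemidef ∧
      ((∑ i, c i * x i : ℝ) : EReal) = valP A B c) ∧
    ((∃ Y : Matrix (Fin n) (Fin n) ℝ, Y.PosSemidef ∧ ∀ i, ((A i) * Y).trace = c i) →
      ∃ Y : Matrix (Fin n) (Fin n) ℝ, Y.PosSemidef ∧ (∀ i, ((A i) * Y).trace = c i) ∧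
        (((B * Y).trace : ℝ) : EReal) = valD A B c) := by
  have hxP : ∀ x : Fin 2 → ℝ, (B - ∑ i, x i • A i).PosSemidef →
      ((∑ i, c i * x i : ℝ) : EReal) ≤ valP A B c := fun x hx =>
    le_sSup ⟨x, hx, rfl⟩
  have hYD : ∀ Y : Matrix (Fin n) (Fin n) ℝ, Y.PosSemidef → (∀ i, ((A i) * Y).trace = c i) →
      valD A B c ≤ ((B * Y).trace : ℝ) := fun Y hY hYc =>
    sInf_le ⟨Y, ⟨hY, hYc⟩, rfl⟩
  constructor
  · obtain ⟨x₀, hx₀⟩ := hfeas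
    obtain ⟨p, hp⟩ : ∃ p : ℝ, valP A B c = p :=
      ⟨_, (EReal.coe_toReal (hgap.trans_le le_top).ne
        ((EReal.bot_lt_coe _).trans_le (hxP x₀ hx₀)).ne').symm⟩
    obtain ⟨p', hpp', hp'⟩ := EReal.lt_iff_exists_real_btwn.1 hgap
    rw [hp] at hpp' hxP
    obtain ⟨x, hx, hxp⟩ := primal_attained_of_gap hsymm hBsymm (EReal.coe_lt_coe_iff.1 hpp')
      (fun x hx => EReal.coe_le_coe_iff.1 (hxP x hx))
      (fun r hr => by
        obtain ⟨_, ⟨x, hx, rfl⟩, hrx⟩ := lt_sSup_iff.1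
          (show (r : EReal) < valP A B c by rw [hp]; exact EReal.coe_lt_coe_iff.2 hr)
        exact ⟨x, hx, EReal.coe_lt_coe_iff.1 hrx⟩)
      (fun Y hY hYc => EReal.coe_lt_coe_iff.1 (hp'.trans_le (hYD Y hY hYc)))
    exact ⟨x, hx, by rw [hxp, hp]⟩
  · rintro ⟨Y₀, hY₀, hY₀c⟩
    obtain ⟨q, hq⟩ : ∃ q : ℝ, valD A B c = q :=
      ⟨_, (EReal.coe_toReal ((hYD Y₀ hY₀ hY₀c).trans_lt (EReal.coe_lt_top _)).ne
        (bot_le.trans_lt hgap).ne').symm⟩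
    rw [hq] at hYD hgap
    have hge : ∀ Y : Matrix (Fin n) (Fin n) ℝ, Y.PosSemidef → (∀ i, (A i * Y).trace = c i) →
        q ≤ (B * Y).trace := fun Y hY hYc => EReal.coe_le_coe_iff.1 (hYD Y hY hYc)
    obtain ⟨Y, hY, hYc, hYq⟩ := dual_attained_of_gap hsymm hBsymm hfeas
      (fun x hx => EReal.coe_lt_coe_iff.1 ((hxP x hx).trans_lt hgap)) hge
      (fun r hr => by
        obtain ⟨_, ⟨Y, ⟨hY, hYc⟩, rfl⟩, hYr⟩ := sInf_lt_iff.1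
          (show valD A B c < (r : EReal) by rw [hq]; exact EReal.coe_lt_coe_iff.2 hr)
        exact ⟨Y, hY, hYc, EReal.coe_lt_coe_iff.1 hYr⟩)
    exact ⟨Y, hY, hYc, by rw [hq, hYq.antisymm (hge Y hY hYc)]⟩
end

section
/- Suppose m = 2, the primal SDP (P) is feasible, and val(P) < val(D). Then the primal objective is constant on the feasible set: c·x = val(P) for every x ∈ ℝ² with B − x₁A₁ − x₂A₂ positive semidefinite. -/
open Matrix

open scoped MatrixOrder in
lemma Matrix.PosSemidef.trace_mul_nonneg_s3 {n : ℕ} {M Y : Matrix (Fin n) (Fin n) ℝ}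
    (hM : M.PosSemidef) (hY : Y.PosSemidef) : 0 ≤ (M * Y).trace := by
  obtain ⟨C, rfl⟩ := CStarAlgebra.nonneg_iff_eq_star_mul_self.mp hM.nonneg
  rw [Matrix.mul_assoc, trace_mul_comm]
  exact (hY.mul_mul_conjTranspose_same C).trace_nonneg

lemma Matrix.posSemidef_of_trace_mul_nonneg {n : ℕ} {M : Matrix (Fin n) (Fin n) ℝ}
    (hM : M.IsSymm) (h : ∀ Y : Matrix (Fin n) (Fin n) ℝ, Y.PosSemidef → 0 ≤ (M * Y).trace) :
    M.PosSemidef := by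
  refine .of_dotProduct_mulVec_nonneg
    (by simpa [IsHermitian, conjTranspose_eq_transpose_of_trivial] using hM.eq) fun v => ?_
  have := h _ (posSemidef_vecMulVec_self_star v)
  rw [mul_vecMulVec, trace_vecMulVec, dotProduct_comm] at this
  exact this

lemma Matrix.PosSemidef.abs_apply_le_trace_s3 {n : ℕ} {Y : Matrix (Fin n) (Fin n) ℝ}
    (hY : Y.PosSemidef) (i j : Fin n) : |Y i j| ≤ Y.trace := by
  have hd : ∀ k, Y k k ≤ Y.trace := fun k =>
    Finset.single_le_sum (f := fun k => Y k k) (fun k _ => hY.diag_nonneg) (Finset.mem_univ k)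
  have hs : Y j i = Y i j := by simpa using hY.isHermitian.apply i j
  have h1 := hY.dotProduct_mulVec_nonneg (Pi.single i 1 + Pi.single j 1)
  have h2 := hY.dotProduct_mulVec_nonneg (Pi.single i 1 - Pi.single j 1)
  simp [mulVec_add, mulVec_sub, add_dotProduct, sub_dotProduct] at h1 h2
  have := hd i
  have := hd j
  rw [abs_le]
  constructor <;> linarith

lemma Matrix.PosSemidef.exists_range_compression {n : ℕ} {Z : Matrix (Fin n) (Fin n) ℝ}
    (hZ : Z.PosSemidef) : ∃ (P : Matrix (Fin n) (Fin n) ℝ) (δ : ℝ), 0 < δ ∧ Pᵀ = P ∧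
      Z * (1 - P) = 0 ∧ (Z - δ • (P * P)).PosSemidef := by
  have hU := hZ.isHermitian.spectral_theorem
  set U : Matrix (Fin n) (Fin n) ℝ := hZ.isHermitian.eigenvectorUnitary.1 with hUdef
  set l := hZ.isHermitian.eigenvalues
  have hl : ∀ i, 0 ≤ l i := hZ.eigenvalues_nonneg
  have hUU : star U * U = 1 := Unitary.coe_star_mul_self hZ.isHermitian.eigenvectorUnitary
  have hZe : Z = U * diagonal l * star U := by
    rw [hU]; simp [Unitary.conjStarAlgAut_apply, hUdef]
  obtain ⟨δ, hδ, hδl⟩ : ∃ δ : ℝ, 0 < δ ∧ ∀ i, l i ≠ 0 → δ ≤ l i := by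
    have : ∀ᶠ δ in nhdsWithin (0 : ℝ) (Set.Ioi 0), ∀ i, l i ≠ 0 → δ ≤ l i := by
      rw [Filter.eventually_all]
      intro i
      by_cases h : l i = 0
      · simp [h]
      · filter_upwards [Ioo_mem_nhdsGT (lt_of_le_of_ne (hl i) (Ne.symm h))] with δ hδ _
        exact hδ.2.le
    obtain ⟨δ, h1, h2⟩ := (this.and self_mem_nhdsWithin).exists
    exact ⟨δ, h2, h1⟩
  set e : Fin n → ℝ := fun i => if l i = 0 then 0 else 1
  refine ⟨U * diagonal e * star U, δ, hδ, ?_, ?_, ?_⟩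
  · simp [star_eq_conjTranspose, Matrix.mul_assoc]
  · have hle : diagonal l * diagonal e = diagonal l := by
      rw [diagonal_mul_diagonal]; congr 1; ext i; by_cases h : l i = 0 <;> simp [e, h]
    rw [Matrix.mul_sub, Matrix.mul_one, sub_eq_zero]
    calc Z = U * (diagonal l * diagonal e) * star U := by rw [hle, ← hZe]
      _ = U * diagonal l * (star U * U) * diagonal e * star U := by
        rw [hUU]; simp [Matrix.mul_assoc]
      _ = (U * diagonal l * star U) * (U * diagonal e * star U) := by
        simp only [Matrix.mul_assoc]
      _ = _ := by rw [← hZe]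
  · have : Z - δ • (U * diagonal e * star U * (U * diagonal e * star U))
        = U * diagonal (fun i => l i - δ * (e i * e i)) * Uᴴ := by
      calc _ = U * diagonal l * star U
              - δ • (U * diagonal e * (star U * U) * diagonal e * star U) := by
            rw [hZe]; simp only [Matrix.mul_assoc]
        _ = U * (diagonal l - δ • (diagonal e * diagonal e)) * star U := by
            rw [hUU]; simp [Matrix.mul_assoc, Matrix.mul_sub, Matrix.sub_mul]
        _ = _ := by
            rw [diagonal_mul_diagonal, ← diagonal_smul, diagonal_sub]; rfl
    rw [this]
    refine (PosSemidef.diagonal fun i => ?_).mul_mul_conjTranspose_same U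
    by_cases h : l i = 0
    · simp [e, h]
    · simpa [e, h] using hδl i h

lemma Convex.exists_ne_zero_forall_le {E : Type*} [NormedAddCommGroup E] [NormedSpace ℝ E]
    [FiniteDimensional ℝ E] {s : Set E} (hs : Convex ℝ s) (h0 : 0 ∈ s) {q : E} (hq : q ∉ s) :
    ∃ f : StrongDual ℝ E, f ≠ 0 ∧ ∀ a ∈ s, f a ≤ f q := by
  by_cases hi : (interior s).Nonempty
  · exact geometric_hahn_banach_of_nonempty_interior_point hs
      (fun h => hq (interior_subset h)) hi
  · rw [hs.interior_nonempty_iff_affineSpan_eq_top] at hi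
    have hlt : Submodule.span ℝ s < ⊤ := by
      refine lt_top_iff_ne_top.mpr fun h => hi ?_
      rw [← Set.insert_eq_of_mem h0]
      apply SetLike.coe_injective
      rw [affineSpan_insert_zero, h]; rfl
    obtain ⟨f, hf, hker⟩ := Submodule.exists_le_ker_of_lt_top _ hlt
    have hz : ∀ a ∈ s, f a = 0 := fun a ha => hker (Submodule.subset_span ha)
    have hc : LinearMap.toContinuousLinearMap f ≠ 0 := by simpa using hf
    rcases le_total 0 (f q) with h | h
    · exact ⟨LinearMap.toContinuousLinearMap f, hc, fun a ha => by simpa [hz a ha] using h⟩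
    · exact ⟨-LinearMap.toContinuousLinearMap f, neg_ne_zero.mpr hc,
        fun a ha => by simpa [hz a ha] using h⟩

/-- The conic image of the dual cone: achievable constraint values together with upper bounds
on the dual objective. -/
def dualImage {n m : ℕ} (A : Fin m → Matrix (Fin n) (Fin n) ℝ)
    (B : Matrix (Fin n) (Fin n) ℝ) : Set ((Fin m → ℝ) × ℝ) :=
  {q | ∃ Y : Matrix (Fin n) (Fin n) ℝ,
    Y.PosSemidef ∧ (∀ i, (A i * Y).trace = q.1 i) ∧ (B * Y).trace ≤ q.2}

section dualImage

variable {n m : ℕ} {A : Fin m → Matrix (Fin n) (Fin n) ℝ} {B : Matrix (Fin n) (Fin n) ℝ}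

lemma zero_mem_dualImage : (0 : (Fin m → ℝ) × ℝ) ∈ dualImage A B :=
  ⟨0, .zero, by simp, by simp⟩

lemma smul_mem_dualImage {q : (Fin m → ℝ) × ℝ} (hq : q ∈ dualImage A B) {t : ℝ} (ht : 0 ≤ t) :
    t • q ∈ dualImage A B := by
  obtain ⟨Y, hY, hA, hB⟩ := hq
  exact ⟨t • Y, hY.smul ht, by simp [hA], by simpa using mul_le_mul_of_nonneg_left hB ht⟩

lemma add_mem_dualImage {q r : (Fin m → ℝ) × ℝ} (hq : q ∈ dualImage A B)
    (hr : r ∈ dualImage A B) : q + r ∈ dualImage A B := by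
  obtain ⟨Y, hY, hA, hB⟩ := hq
  obtain ⟨Y', hY', hA', hB'⟩ := hr
  exact ⟨Y + Y', hY.add hY', by simp [mul_add, hA, hA'], by simpa [mul_add] using add_le_add hB hB'⟩

lemma convex_dualImage : Convex ℝ (dualImage A B) := fun _ hx _ hy _ _ ha hb _ =>
  add_mem_dualImage (smul_mem_dualImage hx ha) (smul_mem_dualImage hy hb)

lemma trace_sub_sum_smul_mul (x : Fin m → ℝ) (Y : Matrix (Fin n) (Fin n) ℝ) :
    ((B - ∑ i, x i • A i) * Y).trace = (B * Y).trace - ∑ i, x i * (A i * Y).trace := by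
  simp [sub_mul, Finset.sum_mul, trace_sum]

lemma isClosed_dualImage (hsymm : ∀ i, (A i).IsSymm) {p : Fin m → ℝ}
    (hp : (B - ∑ i, p i • A i).PosSemidef)
    (hker : ∀ v, (B - ∑ i, p i • A i) *ᵥ v = 0 → ∀ i, A i *ᵥ v = 0) :
    IsClosed (dualImage A B) := by
  obtain ⟨P, δ, hδ, hPt, hZP, hδP⟩ := hp.exists_range_compression
  set Z := B - ∑ i, p i • A i with hZ
  have hAP : ∀ i, A i * P = A i := by
    intro i
    have : A i * (1 - P) = 0 := by
      ext j k
      have h1 : Z *ᵥ (fun l => (1 - P) l k) = 0 := by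
        ext j'; exact congrFun (congrFun hZP j') k
      exact congrFun (hker _ h1 i) j
    rw [mul_sub, mul_one, sub_eq_zero] at this
    exact this.symm
  have hPA : ∀ i, P * A i = A i := by
    intro i
    have := congrArg transpose (hAP i)
    rwa [transpose_mul, hPt, (hsymm i).eq] at this
  have hZP' : Z * P = Z := by
    rw [mul_sub, mul_one, sub_eq_zero] at hZP
    exact hZP.symm
  have hPZ : P * Z = Z := by
    have := congrArg transpose hZP'
    have hZt : Zᵀ = Z := by simpa using hp.isHermitian.eq
    rwa [transpose_mul, hPt, hZt] at this
  have htr : ∀ M Y : Matrix (Fin n) (Fin n) ℝ, M * P = M → P * M = M →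
      (M * (P * Y * P)).trace = (M * Y).trace := by
    intro M Y h1 h2
    rw [← mul_assoc, ← mul_assoc, h1, trace_mul_comm, ← mul_assoc, h2]
  have hB : ∀ Y, (B * Y).trace = (Z * Y).trace + ∑ i, p i * (A i * Y).trace := by
    intro Y; rw [hZ, trace_sub_sum_smul_mul]; ring
  have : FirstCountableTopology (Matrix (Fin n) (Fin n) ℝ) :=
    inferInstanceAs (FirstCountableTopology (Fin n → Fin n → ℝ))
  refine IsSeqClosed.isClosed fun q a hq ha => ?_
  choose Y hY hYA hYB using hq
  have ha1 : ∀ i, Filter.Tendsto (fun k => (q k).1 i) Filter.atTop (nhds (a.1 i)) := fun i =>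
    ((continuous_apply i).comp continuous_fst).continuousAt.tendsto.comp ha
  have ha2 : Filter.Tendsto (fun k => (q k).2) Filter.atTop (nhds a.2) :=
    continuous_snd.continuousAt.tendsto.comp ha
  set Y' := fun k => P * Y k * P with hY'
  have hY'psd : ∀ k, (Y' k).PosSemidef := by
    intro k
    have := (hY k).mul_mul_conjTranspose_same P
    rwa [conjTranspose_eq_transpose_of_trivial, hPt] at this
  have hY'A : ∀ k i, (A i * Y' k).trace = (q k).1 i := fun k i => by
    rw [htr _ _ (hAP i) (hPA i), hYA]
  have hY'B : ∀ k, (B * Y' k).trace ≤ (q k).2 := fun k => by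
    rw [hB, htr _ _ hZP' hPZ]
    simp only [hY'A]
    have := hYB k
    rw [hB] at this
    simpa only [hYA] using this
  obtain ⟨C, hC⟩ : ∃ C, ∀ k, (q k).2 - ∑ i, p i * (q k).1 i ≤ C := by
    have : Filter.Tendsto (fun k => (q k).2 - ∑ i, p i * (q k).1 i) Filter.atTop
        (nhds (a.2 - ∑ i, p i * a.1 i)) :=
      ha2.sub (tendsto_finsetSum _ fun i _ => (ha1 i).const_mul _)
    obtain ⟨C, hC⟩ := this.bddAbove_range
    exact ⟨C, fun k => hC ⟨k, rfl⟩⟩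
  have htrace : ∀ k, (Y' k).trace ≤ C / δ := by
    intro k
    rw [le_div_iff₀ hδ]
    have h1 := hδP.trace_mul_nonneg_s3 (hY k)
    rw [sub_mul, trace_sub, smul_mul_assoc, trace_smul, smul_eq_mul] at h1
    have h2 : (Y' k).trace = (P * P * Y k).trace := by
      rw [hY', trace_mul_comm, mul_assoc]
    have h3 := hYB k
    rw [hB] at h3
    simp only [hYA] at h3
    rw [h2]
    linarith [hC k]
  have hcomp : IsCompact
      {M : Matrix (Fin n) (Fin n) ℝ | ∀ i j, M i j ∈ Set.Icc (-(C / δ)) (C / δ)} := by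
    have hset : {M : Matrix (Fin n) (Fin n) ℝ | ∀ i j, M i j ∈ Set.Icc (-(C / δ)) (C / δ)} =
        (Set.univ.pi fun _ => Set.univ.pi fun _ => Set.Icc (-(C / δ)) (C / δ) :
          Set (Fin n → Fin n → ℝ)) :=
      Set.ext fun _ => ⟨fun h i _ j _ => h i j, fun h i j => h i trivial j trivial⟩
    rw [hset]
    exact isCompact_univ_pi fun _ => isCompact_univ_pi fun _ => isCompact_Icc
  obtain ⟨W, -, φ, hφ, hW⟩ := hcomp.tendsto_subseq (x := Y') fun k i j => by
    exact abs_le.mp (((hY'psd k).abs_apply_le_trace_s3 i j).trans (htrace k))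
  have hlim : ∀ M : Matrix (Fin n) (Fin n) ℝ, Filter.Tendsto (fun k => (M * Y' (φ k)).trace)
      Filter.atTop (nhds (M * W).trace) := by
    intro M
    have hc : Continuous fun W : Matrix (Fin n) (Fin n) ℝ => (M * W).trace := by fun_prop
    exact hc.continuousAt.tendsto.comp hW
  refine ⟨W, ?_, fun i => ?_, ?_⟩
  · have hWs : W.IsSymm := by
      have hc : Continuous fun W : Matrix (Fin n) (Fin n) ℝ => Wᵀ := by fun_prop
      refine tendsto_nhds_unique (hc.continuousAt.tendsto.comp hW) (hW.congr fun k => ?_)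
      have := (hY'psd (φ k)).isHermitian.eq
      rw [conjTranspose_eq_transpose_of_trivial] at this
      exact this.symm
    refine posSemidef_of_trace_mul_nonneg hWs fun M hM => ?_
    rw [trace_mul_comm]
    exact ge_of_tendsto' (hlim M) fun k => hM.trace_mul_nonneg_s3 (hY'psd _)
  · refine tendsto_nhds_unique (hlim (A i)) ?_
    simp only [hY'A]
    exact (ha1 i).comp hφ.tendsto_atTop
  · exact le_of_tendsto_of_tendsto' (hlim B) (ha2.comp hφ.tendsto_atTop) fun k => hY'B _

lemma strongDual_apply_eq_sum (f : StrongDual ℝ ((Fin m → ℝ) × ℝ)) (y : Fin m → ℝ) (t : ℝ) :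
    f (y, t) = ∑ i, y i * f (Pi.single i 1, 0) + t * f (0, 1) := by
  have h1 : (y, t) = ∑ i, y i • ((Pi.single i 1, 0) : (Fin m → ℝ) × ℝ) + t • (0, 1) := by
    ext j
    · simp [Prod.fst_sum, Finset.sum_apply, Pi.single_apply]
    · simp [Prod.snd_sum]
  rw [h1, map_add, map_sum]
  simp only [map_smul, smul_eq_mul]

/-- A functional weakly separating the cone `dualImage A B` from a point `(c, r)` lying strictly
above the primal objective is vertical, vanishes at that point and gives a recession direction of
the primal feasible set. -/
lemma recession_of_separation (hsymm : ∀ i, (A i).IsSymm) (hBsymm : B.IsSymm)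
    {c : Fin m → ℝ} {r : ℝ} (hfeas : ∃ x : Fin m → ℝ, (B - ∑ i, x i • A i).PosSemidef)
    (hr : ∀ x : Fin m → ℝ, (B - ∑ i, x i • A i).PosSemidef → ∑ i, c i * x i < r)
    {f : StrongDual ℝ ((Fin m → ℝ) × ℝ)} (hf : ∀ a ∈ dualImage A B, f a ≤ f (c, r)) :
    f (c, r) = 0 ∧ f (0, 1) = 0 ∧ (-∑ i, f (Pi.single i 1, 0) • A i).PosSemidef := by
  have hq : 0 ≤ f (c, r) := by simpa using hf 0 zero_mem_dualImage
  have hcone : ∀ a ∈ dualImage A B, f a ≤ 0 := by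
    intro a ha
    by_contra! hpos
    have h := hf _ (smul_mem_dualImage ha (t := (f (c, r) + 1) / f a) (by positivity))
    rw [map_smul, smul_eq_mul, div_mul_cancel₀ _ hpos.ne'] at h
    linarith
  have hh : f (0, 1) ≤ 0 := hcone _ ⟨0, .zero, by simp, by simp⟩
  set g : Fin m → ℝ := fun i => f (Pi.single i 1, 0)
  have hsumsymm : ∀ x : Fin m → ℝ, (∑ i, x i • A i).IsSymm := fun x => by
    simp [IsSymm, transpose_sum, (hsymm _).eq]
  have hpsd : (-(f (0, 1) • B) - ∑ i, g i • A i).PosSemidef := by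
    refine posSemidef_of_trace_mul_nonneg ((hBsymm.smul _).neg.sub (hsumsymm g)) fun Y hY => ?_
    have := hcone (fun i => (A i * Y).trace, (B * Y).trace) ⟨Y, hY, fun _ => rfl, le_rfl⟩
    rw [strongDual_apply_eq_sum] at this
    rw [trace_sub_sum_smul_mul]
    simp only [neg_mul, smul_mul_assoc, trace_neg, trace_smul, smul_eq_mul]
    have hcomm : ∑ i, g i * (A i * Y).trace = ∑ i, (A i * Y).trace * f (Pi.single i 1, 0) :=
      Finset.sum_congr rfl fun i _ => mul_comm _ _
    linarith
  have hqe : f (c, r) = ∑ i, c i * g i + r * f (0, 1) := strongDual_apply_eq_sum f c r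
  have h0 : f (0, 1) = 0 := by
    by_contra hne
    have hneg : 0 < -f (0, 1) := by
      have := lt_of_le_of_ne hh hne
      linarith
    have h1 := hpsd.smul (inv_nonneg.mpr hneg.le)
    have h2 := hr (fun i => (-f (0, 1))⁻¹ * g i) (by
      convert h1 using 1
      rw [smul_sub, ← neg_smul, smul_smul, inv_mul_cancel₀ hneg.ne', one_smul, Finset.smul_sum]
      simp only [smul_smul])
    have h3 : ∑ i, c i * ((-f (0, 1))⁻¹ * g i) = (∑ i, c i * g i) / (-f (0, 1)) := by
      rw [Finset.sum_div]
      exact Finset.sum_congr rfl fun i _ => by field_simp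
    rw [h3, div_lt_iff₀ hneg] at h2
    linarith
  have hrec : (-∑ i, g i • A i).PosSemidef := by simpa [h0] using hpsd
  refine ⟨?_, h0, hrec⟩
  refine le_antisymm ?_ hq
  rw [hqe, h0, mul_zero, add_zero]
  obtain ⟨x, hx⟩ := hfeas
  by_contra! hpos
  have hlt := hr x hx
  set t := (r - ∑ i, c i * x i) / ∑ i, c i * g i with ht
  have ht0 : 0 ≤ t := div_nonneg (by linarith) hpos.le
  have h1 := hr (fun i => x i + t * g i) (by
    convert hx.add (hrec.smul ht0) using 1
    simp only [add_smul, Finset.sum_add_distrib, smul_neg, Finset.smul_sum, smul_smul]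
    abel)
  have h2 : ∑ i, c i * (x i + t * g i) = ∑ i, c i * x i + t * ∑ i, c i * g i := by
    rw [Finset.mul_sum, ← Finset.sum_add_distrib]
    exact Finset.sum_congr rfl fun i _ => by ring
  rw [h2, ht, div_mul_cancel₀ _ hpos.ne'] at h1
  linarith

end dualImage

lemma Matrix.PosSemidef.mulVec_eq_zero_of_add_s3 {n : ℕ} {M N : Matrix (Fin n) (Fin n) ℝ}
    (hM : M.PosSemidef) (hN : N.PosSemidef) {v : Fin n → ℝ} (h : (M + N) *ᵥ v = 0) :
    M *ᵥ v = 0 := by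
  have h1 := hM.dotProduct_mulVec_nonneg v
  have h2 := hN.dotProduct_mulVec_nonneg v
  have h3 : star v ⬝ᵥ (M *ᵥ v) + star v ⬝ᵥ (N *ᵥ v) = 0 := by
    rw [← dotProduct_add, ← add_mulVec, h, dotProduct_zero]
  exact (hM.dotProduct_mulVec_zero_iff v).mp (by linarith)

/-- If `m = 2`, the primal SDP (P) is feasible, and there is a positive duality gap
`val(P) < val(D)`, then the primal objective is constant on the feasible set:
`c·x = val(P)` for every feasible `x`. -/
theorem twoVar_gap_objective_constant {n : ℕ}
    (A : Fin 2 → Matrix (Fin n) (Fin n) ℝ) (B : Matrix (Fin n) (Fin n) ℝ)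
    (c : Fin 2 → ℝ)
    (hsymm : ∀ i, (A i).IsSymm) (hBsymm : B.IsSymm)
    (hfeas : ∃ x : Fin 2 → ℝ, (B - ∑ i, x i • A i).PosSemidef)
    (hgap : valP A B c < valD A B c) :
    ∀ x : Fin 2 → ℝ, (B - ∑ i, x i • A i).PosSemidef →
      ((∑ i, c i * x i : ℝ) : EReal) = valP A B c := by
  obtain ⟨r, hPr, hrD⟩ := EReal.lt_iff_exists_real_btwn.mp hgap
  have hr : ∀ x : Fin 2 → ℝ, (B - ∑ i, x i • A i).PosSemidef → ∑ i, c i * x i < r := by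
    intro x hx
    have : ((∑ i, c i * x i : ℝ) : EReal) ≤ valP A B c := le_sSup ⟨x, hx, rfl⟩
    exact_mod_cast this.trans_lt hPr
  have hq : (c, r) ∉ dualImage A B := by
    rintro ⟨Y, hY, hA, hB⟩
    have : valD A B c ≤ ((B * Y).trace : ℝ) := sInf_le ⟨Y, ⟨hY, hA⟩, rfl⟩
    have : (r : EReal) < ((B * Y).trace : ℝ) := hrD.trans_le this
    exact absurd (EReal.coe_lt_coe_iff.mp this) (not_lt.mpr hB)
  obtain ⟨f, hf0, hf⟩ := convex_dualImage.exists_ne_zero_forall_le zero_mem_dualImage hq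
  obtain ⟨hfq, hf1, hrec⟩ := recession_of_separation hsymm hBsymm hfeas hr hf
  set d : Fin 2 → ℝ := fun i => f (Pi.single i 1, 0)
  have hcd : c 0 * d 0 + c 1 * d 1 = 0 := by
    rw [strongDual_apply_eq_sum, hf1, mul_zero, add_zero, Fin.sum_univ_two] at hfq
    exact hfq
  have hd0 : d 0 ≠ 0 ∨ d 1 ≠ 0 := by
    by_contra! h
    refine hf0 (ContinuousLinearMap.ext fun z => ?_)
    obtain ⟨y, t⟩ := z
    have h0 : f (Pi.single 0 1, 0) = 0 := h.1
    have h1 : f (Pi.single 1 1, 0) = 0 := h.2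
    rw [strongDual_apply_eq_sum, hf1, Fin.sum_univ_two, h0, h1]
    simp
  have hconst : ∀ x y : Fin 2 → ℝ, (B - ∑ i, x i • A i).PosSemidef →
      (B - ∑ i, y i • A i).PosSemidef → ∑ i, c i * x i = ∑ i, c i * y i := by
    intro x y hx hy
    by_contra hne
    set p : Fin 2 → ℝ := fun i => (x i + y i + d i) / 2 with hp
    have hsum : B - ∑ i, p i • A i = (1 / 2 : ℝ) •
        ((B - ∑ i, x i • A i) + ((B - ∑ i, y i • A i) + -∑ i, d i • A i)) := by
      simp only [Fin.sum_univ_two, hp]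
      module
    have hyd := hy.add hrec
    have hpsd : (B - ∑ i, p i • A i).PosSemidef := by
      rw [hsum]; exact (hx.add hyd).smul (by norm_num)
    have hker : ∀ v, (B - ∑ i, p i • A i) *ᵥ v = 0 → ∀ i, A i *ᵥ v = 0 := by
      intro v hv
      rw [hsum, smul_mulVec, smul_eq_zero_iff_right (by norm_num)] at hv
      have h1 := hx.mulVec_eq_zero_of_add_s3 hyd hv
      rw [add_comm] at hv
      have h2 := hyd.mulVec_eq_zero_of_add_s3 hx hv
      have h3 := hy.mulVec_eq_zero_of_add_s3 hrec h2
      rw [add_comm] at h2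
      have h4 := hrec.mulVec_eq_zero_of_add_s3 hy h2
      have e1 : (x 0 - y 0) • (A 0 *ᵥ v) + (x 1 - y 1) • (A 1 *ᵥ v) = 0 := by
        have := congrArg₂ (· - ·) h3 h1
        simp only [Fin.sum_univ_two, sub_mulVec, add_mulVec, smul_mulVec] at this
        rw [← sub_self (0 : Fin n → ℝ), ← this]
        module
      have e2 : d 0 • (A 0 *ᵥ v) + d 1 • (A 1 *ᵥ v) = 0 := by
        simpa only [Fin.sum_univ_two, neg_mulVec, add_mulVec, smul_mulVec, neg_eq_zero] using h4
      have hdet : (x 0 - y 0) * d 1 - (x 1 - y 1) * d 0 ≠ 0 := by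
        intro h
        apply hne
        simp only [Fin.sum_univ_two]
        rcases hd0 with h0 | h0
        · apply mul_left_cancel₀ h0
          linear_combination (x 0 - y 0) * hcd - c 1 * h
        · apply mul_left_cancel₀ h0
          linear_combination (x 1 - y 1) * hcd + c 0 * h
      have k0 : A 0 *ᵥ v = 0 := by
        refine (smul_eq_zero_iff_right hdet).mp ?_
        calc _ = d 1 • ((x 0 - y 0) • (A 0 *ᵥ v) + (x 1 - y 1) • (A 1 *ᵥ v))
              - (x 1 - y 1) • (d 0 • (A 0 *ᵥ v) + d 1 • (A 1 *ᵥ v)) := by module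
          _ = 0 := by rw [e1, e2]; simp
      have k1 : A 1 *ᵥ v = 0 := by
        refine (smul_eq_zero_iff_right hdet).mp ?_
        calc _ = (x 0 - y 0) • (d 0 • (A 0 *ᵥ v) + d 1 • (A 1 *ᵥ v))
              - d 0 • ((x 0 - y 0) • (A 0 *ᵥ v) + (x 1 - y 1) • (A 1 *ᵥ v)) := by module
          _ = 0 := by rw [e1, e2]; simp
      exact Fin.forall_fin_two.mpr ⟨k0, k1⟩
    obtain ⟨f', u, hf', hu⟩ := geometric_hahn_banach_closed_point convex_dualImage
      (isClosed_dualImage hsymm hpsd hker) hq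
    have h0 := (recession_of_separation hsymm hBsymm hfeas hr
      fun a ha => ((hf' a ha).trans hu).le).1
    have h1 := hf' 0 zero_mem_dualImage
    rw [map_zero] at h1
    linarith
  intro x hx
  refine le_antisymm (le_sSup ⟨x, hx, rfl⟩) (sSup_le ?_)
  rintro _ ⟨y, hy, rfl⟩
  exact (EReal.coe_le_coe_iff.mpr (hconst y x hy hx).le)
end
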